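/- arXiv:1109.6938 — 12 statements merged into one kernel-verified Lean document; each statement's English description precedes it below -/
import Mathlib

section
/- Let (R, 𝔪) be a commutative local ring, M a finite free R-module, and q : M → R a quadratic form with polar form b(u,v) = q(u+v) − q(u) − q(v). Let v ∈ M be an isotropic vector (q(v) = 0) generating a free rank-one direct summand of M, and suppose v is regular, i.e. there exists w₀ ∈ M with b(v, w₀) a unit of R. Then there exist an element w ∈ M and a submodule M' ≤ M such that q(w) = 0 and b(v, w) = 1, the module M is the internal direct sum of the span of {v, w} and M', and b(u, x) = 0 for every u in the span of {v, w} and every x ∈ M'. In particular, q is isometric to the orthogonal sum of a hyperbolic plane and the restriction of q to M'. -/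
open QuadraticMap

/-- The hyperbolic plane over `R`: the quadratic form on `R × R` given by
`(x, y) ↦ x * y`. -/
def hyperbolicPlane (R : Type*) [CommRing R] : QuadraticForm R (R × R) :=
  LinearMap.BilinMap.toQuadraticMap ((LinearMap.mul R R).compl₁₂ (LinearMap.fst R R R) (LinearMap.snd R R R))

section HyperbolicPair

variable {R M : Type*} [CommRing R] [AddCommGroup M] [Module R M]

/-- The submodule of vectors polar-orthogonal to both `v` and `w`. -/
def orthogonalPair (q : QuadraticForm R M) (v w : M) : Submodule R M :=
  LinearMap.ker (q.polarBilin v) ⊓ LinearMap.ker (q.polarBilin w)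

lemma mem_orthogonalPair {q : QuadraticForm R M} {v w x : M} :
    x ∈ orthogonalPair q v w ↔ polar q v x = 0 ∧ polar q w x = 0 :=
  Iff.rfl

variable {q : QuadraticForm R M} {v w : M}

lemma polar_eq_zero_of_mem_span_pair {u x : M} (hu : u ∈ Submodule.span R ({v, w} : Set M))
    (hx : x ∈ orthogonalPair q v w) : polar q u x = 0 := by
  obtain ⟨a, b, rfl⟩ := Submodule.mem_span_pair.1 hu
  obtain ⟨h₁, h₂⟩ := mem_orthogonalPair.1 hx
  simp [polar_add_left, polar_smul_left, h₁, h₂]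

lemma polar_left_hyperbolicPair (hv : q v = 0) (hvw : polar q v w = 1) (a b : R) :
    polar q v (a • v + b • w) = b := by
  simp [polar_add_right, polar_smul_right, polar_self, hv, hvw]

lemma polar_right_hyperbolicPair (hw : q w = 0) (hvw : polar q v w = 1) (a b : R) :
    polar q w (a • v + b • w) = a := by
  simp [polar_add_right, polar_smul_right, polar_self, hw, polar_comm q w v, hvw]

lemma sub_mem_orthogonalPair (hv : q v = 0) (hw : q w = 0) (hvw : polar q v w = 1) (x : M) :
    x - (polar q w x • v + polar q v x • w) ∈ orthogonalPair q v w := by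
  rw [mem_orthogonalPair, polar_sub_right, polar_sub_right, polar_left_hyperbolicPair hv hvw,
    polar_right_hyperbolicPair hw hvw]
  simp

lemma isCompl_span_orthogonalPair (hv : q v = 0) (hw : q w = 0) (hvw : polar q v w = 1) :
    IsCompl (Submodule.span R ({v, w} : Set M)) (orthogonalPair q v w) := by
  constructor
  · rw [Submodule.disjoint_def]
    intro u hu hx
    obtain ⟨a, b, rfl⟩ := Submodule.mem_span_pair.1 hu
    rw [mem_orthogonalPair, polar_left_hyperbolicPair hv hvw,
      polar_right_hyperbolicPair hw hvw] at hx
    simp [hx.1, hx.2]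
  · rw [codisjoint_iff, eq_top_iff]
    intro x _
    exact Submodule.mem_sup.2 ⟨_, Submodule.mem_span_pair.2 ⟨_, _, rfl⟩, _,
      sub_mem_orthogonalPair hv hw hvw x, add_sub_cancel _ _⟩

lemma map_hyperbolicPair_add (hv : q v = 0) (hw : q w = 0) (hvw : polar q v w = 1) (a b : R)
    {x : M} (hx : x ∈ orthogonalPair q v w) :
    q (a • v + b • w + x) = a * b + q x := by
  have h := polar_eq_zero_of_mem_span_pair (Submodule.mem_span_pair.2 ⟨a, b, rfl⟩) hx
  rw [QuadraticMap.map_add q (a • v + b • w), h, QuadraticMap.map_add q (a • v)]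
  simp [QuadraticMap.map_smul, polar_smul_left, polar_smul_right, hv, hw, hvw, mul_comm]

/-- The linear equivalence splitting off a hyperbolic pair. -/
def hyperbolicPairEquiv (hv : q v = 0) (hw : q w = 0) (hvw : polar q v w = 1) :
    M ≃ₗ[R] (R × R) × orthogonalPair q v w where
  toFun x := ((polar q w x, polar q v x), ⟨_, sub_mem_orthogonalPair hv hw hvw x⟩)
  invFun p := p.1.1 • v + p.1.2 • w + p.2
  map_add' x y := by
    ext <;> simp only [polar_add_right, Prod.mk_add_mk, Submodule.coe_add]
    module
  map_smul' r x := by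
    ext <;> simp only [polar_smul_right, Prod.smul_mk, Submodule.coe_smul, RingHom.id_apply]
    module
  left_inv x := add_sub_cancel _ _
  right_inv p := by
    obtain ⟨⟨a, b⟩, x, hx⟩ := p
    obtain ⟨h₁, h₂⟩ := mem_orthogonalPair.1 hx
    have hb : polar q v (a • v + b • w + x) = b := by
      rw [polar_add_right, polar_left_hyperbolicPair hv hvw, h₁, add_zero]
    have ha : polar q w (a • v + b • w + x) = a := by
      rw [polar_add_right, polar_right_hyperbolicPair hw hvw, h₂, add_zero]
    ext <;> simp [ha, hb]

lemma equivalent_hyperbolicPlane_prod (hv : q v = 0) (hw : q w = 0) (hvw : polar q v w = 1) :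
    QuadraticMap.Equivalent q
      ((hyperbolicPlane R).prod (q.comp (orthogonalPair q v w).subtype)) := by
  refine QuadraticMap.Equivalent.symm ⟨⟨(hyperbolicPairEquiv hv hw hvw).symm, fun p => ?_⟩⟩
  exact map_hyperbolicPair_add hv hw hvw p.1.1 p.1.2 p.2.2

lemma exists_hyperbolicPair (hv : q v = 0) (h : ∃ w₀ : M, IsUnit (polar q v w₀)) :
    ∃ w : M, q w = 0 ∧ polar q v w = 1 := by
  obtain ⟨w₀, c, hc⟩ := h
  obtain ⟨w₁, h₁⟩ : ∃ w₁, polar q v w₁ = 1 :=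
    ⟨(↑c⁻¹ : R) • w₀, by rw [polar_smul_right, ← hc, smul_eq_mul, Units.inv_mul]⟩
  refine ⟨w₁ + (-q w₁) • v, ?_, ?_⟩
  · rw [QuadraticMap.map_add q w₁, polar_smul_right, polar_comm q w₁ v, h₁, QuadraticMap.map_smul,
      hv]
    simp
  · rw [polar_add_right, polar_smul_right, h₁, polar_self, hv]
    simp

end HyperbolicPair

/-- **Local hyperbolic splitting, rank one case** (Lemma 3.2 of
"Fibrations in complete intersections of quadrics"): over a local ring, a regular
isotropic vector generating a free rank-one direct summand splits off a hyperbolic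
plane. -/
theorem local_hyperbolic_splitting_rank_one
    {R M : Type*} [CommRing R] [IsLocalRing R]
    [AddCommGroup M] [Module R M] [Module.Free R M] [Module.Finite R M]
    (q : QuadraticForm R M) (v : M)
    (hiso : q v = 0)
    (hfree : Function.Injective fun r : R => r • v)
    (hsummand : ∃ C : Submodule R M, IsCompl (Submodule.span R {v}) C)
    (hreg : ∃ w₀ : M, IsUnit (polar q v w₀)) :
    ∃ (w : M) (M' : Submodule R M),
      q w = 0 ∧ polar q v w = 1 ∧
      IsCompl (Submodule.span R ({v, w} : Set M)) M' ∧
      (∀ u ∈ Submodule.span R ({v, w} : Set M), ∀ x ∈ M', polar q u x = 0) ∧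
      QuadraticMap.Equivalent q ((hyperbolicPlane R).prod (q.comp M'.subtype)) := by
  obtain ⟨w, hw, hvw⟩ := exists_hyperbolicPair hiso hreg
  exact ⟨w, orthogonalPair q v w, hw, hvw, isCompl_span_orthogonalPair hiso hw hvw,
    fun _ hu _ hx => polar_eq_zero_of_mem_span_pair hu hx,
    equivalent_hyperbolicPlane_prod hiso hw hvw⟩
end

section
/- Let (R, 𝔪) be a commutative local ring, M a finite free R-module, and q : M → R a quadratic form with polar form b(u,v) = q(u+v) − q(u) − q(v). Let v : Fin r → M be such that the vᵢ form a basis of a free direct summand N of M of rank r, q vanishes identically on N (so in particular q(vᵢ) = 0 and b(vᵢ, vⱼ) = 0 for all i, j), and N is regular in the sense that the R-linear map M → Hom_R(N, R) sending u to the restriction of b(u, ·) to N is surjective. Then there exist w : Fin r → M and a submodule M' ≤ M such that: q(wᵢ) = 0 and b(wᵢ, wⱼ) = 0 for all i, j; b(vᵢ, wⱼ) equals 1 if i = j and 0 otherwise; M is the internal direct sum of N, the span of the wᵢ, and M'; and b(u, x) = 0 whenever u lies in the submodule spanned by the vᵢ and wᵢ and x ∈ M'. In particular, q is isometric to the orthogonal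 sum of the hyperbolic form on N ⊕ Hom_R(N, R), given by (n, f) ↦ f(n), and the restriction of q to M'. -/
open QuadraticMap

/-- A linear form on a submodule spanned by a finite linearly independent family that is
prescribed on the family. -/
theorem exists_dual_apply_eq {R M ι : Type*} [CommRing R] [AddCommGroup M] [Module R M]
    {v : ι → M} {N : Submodule R M} (hindep : LinearIndependent R v)
    (hspan : Submodule.span R (Set.range v) = N) (c : ι → R) :
    ∃ φ : Module.Dual R N, ∀ i (h : v i ∈ N), φ ⟨v i, h⟩ = c i := by
  subst hspan
  refine ⟨(Module.Basis.span hindep).constr R c, fun i h ↦ ?_⟩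
  have : (⟨v i, h⟩ : Submodule.span R (Set.range v)) = Module.Basis.span hindep i :=
    by
    rw [Module.Basis.span_apply]
  rw [this, Module.Basis.constr_basis]

/-- The polar form vanishes on two spans as soon as it vanishes on the generators. -/
theorem QuadraticMap.polar_eq_zero_of_mem_span {R M : Type*} [CommRing R] [AddCommGroup M]
    [Module R M] (q : QuadraticForm R M) {s t : Set M}
    (h : ∀ x ∈ s, ∀ y ∈ t, polar q x y = 0) {x y : M}
    (hx : x ∈ Submodule.span R s) (hy : y ∈ Submodule.span R t) : polar q x y = 0 := by
  induction hx, hy using Submodule.span_induction₂ with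
  | mem_mem x y hx hy => exact h x hx y hy
  | zero_left y hy => simp
  | zero_right x hx => simp
  | add_left x y z _ _ _ h₁ h₂ => simp [h₁, h₂]
  | add_right x y z _ _ _ h₁ h₂ => simp [h₁, h₂]
  | smul_left r x y _ _ h₁ => simp [h₁]
  | smul_right r x y _ _ h₁ => simp [h₁]

/-- A quadratic form vanishes on a span as soon as it and its polar form vanish on the
generators. -/
theorem QuadraticMap.eq_zero_of_mem_span {R M : Type*} [CommRing R] [AddCommGroup M]
    [Module R M] (q : QuadraticForm R M) {s : Set M} (hq : ∀ x ∈ s, q x = 0)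
    (h : ∀ x ∈ s, ∀ y ∈ s, polar q x y = 0) {x : M}
    (hx : x ∈ Submodule.span R s) : q x = 0 := by
  induction hx using Submodule.span_induction with
  | mem x hx => exact hq x hx
  | zero => simp
  | add x y hx hy h₁ h₂ =>
    rw [QuadraticMap.map_add q, h₁, h₂, polar_eq_zero_of_mem_span q h hx hy]
    simp
  | smul r x _ h₁ => simp [QuadraticMap.map_smul, h₁]

/-- The polar form against a linear combination. -/
theorem QuadraticMap.polar_sum_smul_right {R M ι : Type*} [CommRing R] [AddCommGroup M]
    [Module R M] [Fintype ι] (q : QuadraticForm R M) (x : M) (c : ι → R) (v : ι → M) :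
    polar q x (∑ i, c i • v i) = ∑ i, c i * polar q x (v i) := by
  rw [← polarBilin_apply_apply, map_sum]
  simp

/-- A family dual to a totally isotropic family can be corrected to a dual family that is itself
totally isotropic. -/
theorem QuadraticMap.exists_isotropic_dual_family {R M ι : Type*} [CommRing R] [AddCommGroup M]
    [Module R M] [Fintype ι] [LinearOrder ι] (q : QuadraticForm R M) (v u : ι → M)
    (hv : ∀ i, q (v i) = 0) (hvv : ∀ i j, polar q (v i) (v j) = 0)
    (huv : ∀ i j, polar q (u i) (v j) = if i = j then (1 : R) else 0) :
    ∃ w : ι → M, (∀ i, q (w i) = 0) ∧ (∀ i j, polar q (w i) (w j) = 0) ∧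
      ∀ i j, polar q (v i) (w j) = if i = j then (1 : R) else 0 := by
  let a : ι → ι → R := fun i j ↦
    if j < i then polar q (u i) (u j) else if i = j then q (u i) else 0
  have haa (i j) : a i j + a j i = polar q (u i) (u j) := by
    rcases lt_trichotomy i j with h | rfl | h
    · simp [a, h, h.not_gt, h.ne, polar_comm q (u i)]
    · simp [a, polar_self, two_mul]
    · simp [a, h, h.not_gt, h.ne]
  let s : ι → M := fun i ↦ ∑ j, a i j • v j
  have hs (i) : s i ∈ Submodule.span R (Set.range v) :=
    Submodule.sum_mem _ fun j _ ↦ Submodule.smul_mem _ _ (Submodule.subset_span ⟨j, rfl⟩)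
  have hvv' : ∀ x ∈ Set.range v, ∀ y ∈ Set.range v, polar q x y = 0 := by
    rintro _ ⟨i, rfl⟩ _ ⟨j, rfl⟩
    exact hvv i j
  have hus (i j) : polar q (u i) (s j) = a j i := by
    simp [s, polar_sum_smul_right, huv]
  have hss (i j) : polar q (s i) (s j) = 0 := polar_eq_zero_of_mem_span q hvv' (hs i) (hs j)
  have hqs (i) : q (s i) = 0 :=
    eq_zero_of_mem_span q (by rintro _ ⟨i, rfl⟩; exact hv i) hvv' (hs i)
  refine ⟨fun i ↦ u i - s i, fun i ↦ ?_, fun i j ↦ ?_, fun i j ↦ ?_⟩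
  · have h : q (u i - s i) = q (u i) + q (s i) - polar q (u i) (s i) := by
      rw [sub_eq_add_neg, QuadraticMap.map_add q, QuadraticMap.map_neg, polar_neg_right]
      ring
    simp [h, hqs, hus, a]
  · simp only [polar_sub_left, polar_sub_right, hus, hss, polar_comm q (s i), ← haa i j]
    ring
  · have h : polar q (v i) (s j) = 0 :=
      polar_eq_zero_of_mem_span q hvv' (Submodule.subset_span ⟨i, rfl⟩) (hs j)
    rw [polar_sub_right, h, polar_comm, huv, sub_zero]
    simp [eq_comm]

/-- Three submodules through which every element decomposes uniquely form an internal direct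
sum. -/
theorem DirectSum.isInternal_three {R M : Type*} [Ring R] [AddCommGroup M] [Module R M]
    (A B C : Submodule R M)
    (hinj : ∀ a ∈ A, ∀ b ∈ B, ∀ c ∈ C, a + b + c = 0 → a = 0 ∧ b = 0 ∧ c = 0)
    (hsurj : ∀ x, ∃ a ∈ A, ∃ b ∈ B, ∃ c ∈ C, a + b + c = x) :
    DirectSum.IsInternal ![A, B, C] := by
  classical
  rw [DirectSum.isInternal_submodule_iff_iSupIndep_and_iSup_eq_top]
  constructor
  · refine iSupIndep_of_dfinsupp_lsum_injective _ ((injective_iff_map_eq_zero _).2 fun f hf ↦ ?_)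
    rw [DFinsupp.lsum_apply_apply, DFinsupp.sumAddHom_apply, DFinsupp.sum_eq_sum_fintype _ (by simp),
      Fin.sum_univ_three] at hf
    obtain ⟨h₁, h₂, h₃⟩ := hinj _ (f 0).2 _ (f 1).2 _ (f 2).2 hf
    ext i
    fin_cases i
    exacts [h₁, h₂, h₃]
  · refine eq_top_iff.2 fun x _ ↦ ?_
    obtain ⟨a, ha, b, hb, c, hc, rfl⟩ := hsurj x
    exact add_mem (add_mem (Submodule.mem_iSup_of_mem (0 : Fin 3) ha)
      (Submodule.mem_iSup_of_mem (1 : Fin 3) hb)) (Submodule.mem_iSup_of_mem (2 : Fin 3) hc)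

/-- **Local hyperbolic splitting** (Lemma 3.2 of "Fibrations in complete intersections of
quadrics"): over a local ring, a regular totally isotropic free direct summand of rank `r`
of a quadratic form can be split off, together with a dual family, yielding an orthogonal
decomposition of the form as a hyperbolic form plus a complement. -/
theorem local_hyperbolic_splitting
    {R M : Type*} [CommRing R] [IsLocalRing R]
    [AddCommGroup M] [Module R M] [Module.Free R M] [Module.Finite R M]
    (q : QuadraticForm R M) (r : ℕ) (v : Fin r → M) (N : Submodule R M)
    (hindep : LinearIndependent R v)
    (hspan : Submodule.span R (Set.range v) = N)
    (hsummand : ∃ C : Submodule R M, IsCompl N C)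
    (hvanish : ∀ x ∈ N, q x = 0)
    (hreg : Function.Surjective fun u : M => (QuadraticMap.polarBilin q u).comp N.subtype) :
    ∃ (w : Fin r → M) (M' : Submodule R M),
      (∀ i, q (w i) = 0) ∧
      (∀ i j, polar q (w i) (w j) = 0) ∧
      (∀ i j, polar q (v i) (w j) = if i = j then (1 : R) else 0) ∧
      DirectSum.IsInternal ![N, Submodule.span R (Set.range w), M'] ∧
      (∀ u ∈ N ⊔ Submodule.span R (Set.range w), ∀ x ∈ M', polar q u x = 0) ∧
      QuadraticMap.Equivalent q
        (((QuadraticForm.dualProd R N).comp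
            (LinearEquiv.prodComm R N (Module.Dual R N)).toLinearMap).prod
          (q.comp M'.subtype)) := by
  have hvN (i) : v i ∈ N := hspan ▸ Submodule.subset_span ⟨i, rfl⟩
  have hNN {x y : M} (hx : x ∈ N) (hy : y ∈ N) : polar q x y = 0 := by
    simp [polar, hvanish _ hx, hvanish _ hy, hvanish _ (add_mem hx hy)]
  choose φ hφ using fun i ↦ exists_dual_apply_eq hindep hspan (Pi.single i (1 : R))
  choose u hu using fun i ↦ hreg (φ i)
  have huv (i j) : polar q (u i) (v j) = if i = j then (1 : R) else 0 := by
    have := LinearMap.congr_fun (hu i) ⟨v j, hvN j⟩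
    simpa [hφ, Pi.single_apply, eq_comm] using this
  obtain ⟨w, hw, hww, hvw⟩ := exists_isotropic_dual_family q v u
    (fun i ↦ hvanish _ (hvN i)) (fun i j ↦ hNN (hvN i) (hvN j)) huv
  have hwv (i j) : polar q (w i) (v j) = if i = j then (1 : R) else 0 := by
    rw [polar_comm, hvw]; simp [eq_comm]
  set W := Submodule.span R (Set.range w)
  have hwW (i) : w i ∈ W := Submodule.subset_span ⟨i, rfl⟩
  have hww' : ∀ x ∈ Set.range w, ∀ y ∈ Set.range w, polar q x y = 0 := by
    rintro _ ⟨i, rfl⟩ _ ⟨j, rfl⟩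
    exact hww i j
  have hWW {x y : M} (hx : x ∈ W) (hy : y ∈ W) : polar q x y = 0 :=
    polar_eq_zero_of_mem_span q hww' hx hy
  have hW {x : M} (hx : x ∈ W) : q x = 0 :=
    eq_zero_of_mem_span q (by rintro _ ⟨i, rfl⟩; exact hw i) hww' hx
  have hNrepr {x : M} (hx : x ∈ N) : ∑ i, polar q (w i) x • v i = x := by
    rw [← hspan] at hx
    obtain ⟨c, rfl⟩ := (Submodule.mem_span_range_iff_exists_fun R).1 hx
    simp [polar_sum_smul_right, hwv]
  have hWrepr {x : M} (hx : x ∈ W) : ∑ i, polar q (v i) x • w i = x := by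
    obtain ⟨c, rfl⟩ := (Submodule.mem_span_range_iff_exists_fun R).1 hx
    simp [polar_sum_smul_right, hvw]
  let M' : Submodule R M :=
    LinearMap.ker (LinearMap.pi fun i ↦ polarBilin q (v i)) ⊓
      LinearMap.ker (LinearMap.pi fun i ↦ polarBilin q (w i))
  have hM' {x : M} : x ∈ M' ↔ (∀ i, polar q (v i) x = 0) ∧ ∀ i, polar q (w i) x = 0 := by
    simp [M', funext_iff]
  have hNM {x y : M} (hx : x ∈ N) (hy : y ∈ M') : polar q x y = 0 := by
    rw [← hspan] at hx
    refine polar_eq_zero_of_mem_span q ?_ hx (Submodule.subset_span (Set.mem_singleton y))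
    rintro _ ⟨i, rfl⟩ _ rfl
    exact (hM'.1 hy).1 i
  have hWM {x y : M} (hx : x ∈ W) (hy : y ∈ M') : polar q x y = 0 := by
    refine polar_eq_zero_of_mem_span q ?_ hx (Submodule.subset_span (Set.mem_singleton y))
    rintro _ ⟨i, rfl⟩ _ rfl
    exact (hM'.1 hy).2 i
  have hinj : ∀ a ∈ N, ∀ b ∈ W, ∀ c ∈ M', a + b + c = 0 → a = 0 ∧ b = 0 ∧ c = 0 := by
    intro a ha b hb c hc h
    have ha0 : a = 0 := by
      rw [← hNrepr ha]
      refine Finset.sum_eq_zero fun i _ ↦ ?_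
      have : polar q (w i) (a + b + c) = 0 := by rw [h, polar_zero_right]
      rw [polar_add_right, polar_add_right, hWW (hwW i) hb, hWM (hwW i) hc] at this
      simp_all
    have hb0 : b = 0 := by
      rw [← hWrepr hb]
      refine Finset.sum_eq_zero fun i _ ↦ ?_
      have : polar q (v i) (a + b + c) = 0 := by rw [h, polar_zero_right]
      rw [polar_add_right, polar_add_right, hNN (hvN i) ha, hNM (hvN i) hc] at this
      simp_all
    simp_all
  have hsurj (x : M) : ∃ a ∈ N, ∃ b ∈ W, ∃ c ∈ M', a + b + c = x := by
    refine ⟨∑ i, polar q (w i) x • v i,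
      Submodule.sum_mem _ fun i _ ↦ Submodule.smul_mem _ _ (hvN i),
      ∑ i, polar q (v i) x • w i,
      Submodule.sum_mem _ fun i _ ↦ Submodule.smul_mem _ _ (hwW i),
      x - (∑ i, polar q (w i) x • v i + ∑ i, polar q (v i) x • w i), ?_, by abel⟩
    rw [hM']
    constructor <;> intro i <;>
      simp [polar_sub_right, polar_add_right, polar_sum_smul_right, hvw, hwv, hww,
        hNN (hvN _) (hvN _)]
  refine ⟨w, M', hw, hww, hvw, DirectSum.isInternal_three _ _ _ hinj hsurj, ?_, ?_⟩
  · intro x hx y hy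
    obtain ⟨a, ha, b, hb, rfl⟩ := Submodule.mem_sup.1 hx
    rw [polar_add_left, hNM ha hy, hWM hb hy, add_zero]
  let g : Module.Dual R N →ₗ[R] M :=
    ∑ i, (Module.Dual.eval R N ⟨v i, hvN i⟩).smulRight (w i)
  have hg (f) : g f = ∑ i, f ⟨v i, hvN i⟩ • w i := by simp [g]
  have hgW (f) : g f ∈ W := by
    rw [hg]
    exact Submodule.sum_mem _ fun i _ ↦ Submodule.smul_mem _ _ (hwW i)
  have hgN (f : Module.Dual R N) (n : N) : polar q (n : M) (g f) = f n := by
    have hn : n = ∑ i, polar q (w i) (n : M) • (⟨v i, hvN i⟩ : N) :=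
      Subtype.ext (by simpa using (hNrepr n.2).symm)
    rw [hg, polar_sum_smul_right]
    conv_rhs => rw [hn, map_sum]
    exact Finset.sum_congr rfl fun i _ ↦ by
      rw [_root_.map_smul, smul_eq_mul, mul_comm, polar_comm]
  let e : ((N × Module.Dual R N) × M') →ₗ[R] M := (N.subtype.coprod g).coprod M'.subtype
  have he (p) : e p = p.1.1 + g p.1.2 + p.2 := by simp [e]
  have hbij : Function.Bijective e := by
    constructor
    · rw [injective_iff_map_eq_zero]
      rintro ⟨⟨n, f⟩, m⟩ h
      rw [he] at h
      obtain ⟨h₁, h₂, h₃⟩ := hinj _ n.2 _ (hgW f) _ m.2 h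
      have hf : f = 0 := LinearMap.ext fun n ↦ by rw [← hgN, h₂]; simp
      exact Prod.ext (Prod.ext (Subtype.ext h₁) hf) (Subtype.ext h₃)
    · intro x
      obtain ⟨a, ha, b, hb, c, hc, rfl⟩ := hsurj x
      refine ⟨((⟨a, ha⟩, (polarBilin q b).comp N.subtype), ⟨c, hc⟩), ?_⟩
      have hgb : g ((polarBilin q b).comp N.subtype) = b := by
        rw [hg]
        refine Eq.trans (Finset.sum_congr rfl fun i _ ↦ ?_) (hWrepr hb)
        rw [polar_comm]
        rfl
      rw [he, hgb]
  refine QuadraticMap.Equivalent.symm ⟨⟨LinearEquiv.ofBijective e hbij, fun p ↦ ?_⟩⟩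
  change q (e p) = _
  rw [he, QuadraticMap.map_add q, QuadraticMap.map_add q, hvanish _ p.1.1.2, hW (hgW _),
    polar_add_left, hNM p.1.1.2 p.2.2, hWM (hgW _) p.2.2, hgN]
  simp
end

section
/- Let R be a commutative ring, M₁ and M₂ R-modules, and Q₁ : M₁ → R, Q₂ : M₂ → R quadratic forms. Let Q₁ ⊥ Q₂ denote the orthogonal sum on M₁ × M₂, given by (m₁, m₂) ↦ Q₁ m₁ + Q₂ m₂. Then there is an isomorphism of R-modules between the even part of the Clifford algebra of Q₁ ⊥ Q₂ and the direct sum (C₀(Q₁) ⊗[R] C₀(Q₂)) ⊕ (C₁(Q₁) ⊗[R] C₁(Q₂)), where C₀ and C₁ denote the even and odd parts of the respective Clifford algebras. -/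
open TensorProduct

namespace CliffordAlgebra

section Grading

variable {R M N : Type*} [CommRing R] [AddCommGroup M] [AddCommGroup N] [Module R M] [Module R N]

theorem map_mem_evenOdd {Q : QuadraticForm R M} {Q' : QuadraticForm R N} (f : Q →qᵢ Q')
    {i : ZMod 2} {x : CliffordAlgebra Q} (hx : x ∈ evenOdd Q i) : map f x ∈ evenOdd Q' i := by
  have hle : (evenOdd Q i).map (map f).toLinearMap ≤ evenOdd Q' i := by
    rw [evenOdd, Submodule.map_iSup]
    refine iSup_mono fun j => ?_
    rw [Submodule.map_pow]
    refine pow_le_pow_left' ?_ _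
    rintro _ ⟨_, ⟨m, rfl⟩, rfl⟩
    exact ⟨f m, (map_apply_ι f m).symm⟩
  exact hle ⟨x, hx, rfl⟩

/-- The projection of the Clifford algebra onto its even or odd part. -/
noncomputable def evenOddProj (Q : QuadraticForm R M) (i : ZMod 2) :
    CliffordAlgebra Q →ₗ[R] evenOdd Q i :=
  DirectSum.component R (ZMod 2) (fun i => evenOdd Q i) i ∘ₗ
    (DirectSum.decomposeLinearEquiv (evenOdd Q)).toLinearMap

theorem evenOddProj_of_mem {Q : QuadraticForm R M} {i : ZMod 2} {x : CliffordAlgebra Q}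
    (hx : x ∈ evenOdd Q i) : evenOddProj Q i x = ⟨x, hx⟩ :=
  Subtype.ext (DirectSum.decompose_of_mem_same _ hx)

theorem evenOddProj_of_mem_of_ne {Q : QuadraticForm R M} {i j : ZMod 2} {x : CliffordAlgebra Q}
    (hx : x ∈ evenOdd Q i) (hij : i ≠ j) : evenOddProj Q j x = 0 :=
  Subtype.ext (DirectSum.decompose_of_mem_ne _ hx hij)

@[simp]
theorem evenOddProj_coe {Q : QuadraticForm R M} {i : ZMod 2} (x : evenOdd Q i) :
    evenOddProj Q i x = x :=
  evenOddProj_of_mem x.2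

end Grading

section Prod

variable {R M₁ M₂ : Type*} [CommRing R] [AddCommGroup M₁] [AddCommGroup M₂]
  [Module R M₁] [Module R M₂] (Q₁ : QuadraticForm R M₁) (Q₂ : QuadraticForm R M₂)

theorem toProd_tmul_mem_evenOdd {i j : ZMod 2} {a : CliffordAlgebra Q₁} {b : CliffordAlgebra Q₂}
    (ha : a ∈ evenOdd Q₁ i) (hb : b ∈ evenOdd Q₂ j) :
    toProd Q₁ Q₂ (a ᵍ⊗ₜ b) ∈ evenOdd (Q₁.prod Q₂) (i + j) := by
  rw [toProd, GradedTensorProduct.lift_tmul]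
  exact SetLike.mul_mem_graded (map_mem_evenOdd _ ha) (map_mem_evenOdd _ hb)

/-- The components of bidegrees `(0, 0)` and `(1, 1)` of an element of the tensor product. -/
noncomputable def tensorEvenProj :
    CliffordAlgebra Q₁ ⊗[R] CliffordAlgebra Q₂ →ₗ[R]
      (evenOdd Q₁ 0 ⊗[R] evenOdd Q₂ 0) × (evenOdd Q₁ 1 ⊗[R] evenOdd Q₂ 1) :=
  (TensorProduct.map (evenOddProj Q₁ 0) (evenOddProj Q₂ 0)).prod
    (TensorProduct.map (evenOddProj Q₁ 1) (evenOddProj Q₂ 1))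

/-- The map induced by the inclusions of the homogeneous parts. -/
noncomputable def tensorEvenIncl :
    (evenOdd Q₁ 0 ⊗[R] evenOdd Q₂ 0) × (evenOdd Q₁ 1 ⊗[R] evenOdd Q₂ 1) →ₗ[R]
      CliffordAlgebra Q₁ ⊗[R] CliffordAlgebra Q₂ :=
  (TensorProduct.map (evenOdd Q₁ 0).subtype (evenOdd Q₂ 0).subtype).coprod
    (TensorProduct.map (evenOdd Q₁ 1).subtype (evenOdd Q₂ 1).subtype)

theorem tensorEvenProj_comp_tensorEvenIncl :
    tensorEvenProj Q₁ Q₂ ∘ₗ tensorEvenIncl Q₁ Q₂ = LinearMap.id := by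
  have h₁ (a : evenOdd Q₁ 0) : evenOddProj Q₁ 1 a = 0 := evenOddProj_of_mem_of_ne a.2 (by decide)
  have h₂ (a : evenOdd Q₁ 1) : evenOddProj Q₁ 0 a = 0 := evenOddProj_of_mem_of_ne a.2 (by decide)
  apply LinearMap.prod_ext <;> apply TensorProduct.ext' <;> intro a b <;>
    simp [tensorEvenProj, tensorEvenIncl, h₁, h₂]

theorem evenOddProj_zero_toProd (t : CliffordAlgebra Q₁ ⊗[R] CliffordAlgebra Q₂) :
    (evenOddProj (Q₁.prod Q₂) 0 (toProd Q₁ Q₂ (GradedTensorProduct.of R _ _ t)) :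
        CliffordAlgebra (Q₁.prod Q₂)) =
      toProd Q₁ Q₂ (GradedTensorProduct.of R _ _
        (tensorEvenIncl Q₁ Q₂ (tensorEvenProj Q₁ Q₂ t))) := by
  induction t with
  | zero => simp
  | add x y hx hy => simp only [map_add, Submodule.coe_add, hx, hy]
  | tmul a b =>
    induction a using DirectSum.Decomposition.inductionOn (evenOdd Q₁) with
    | zero => simp
    | add x y hx hy => simp only [TensorProduct.add_tmul, map_add, Submodule.coe_add, hx, hy]
    | @homogeneous i a =>
      induction b using DirectSum.Decomposition.inductionOn (evenOdd Q₂) with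
      | zero => simp
      | add x y hx hy => simp only [TensorProduct.tmul_add, map_add, Submodule.coe_add, hx, hy]
      | @homogeneous j b =>
        have hab := toProd_tmul_mem_evenOdd Q₁ Q₂ a.2 b.2
        by_cases hij : i = j
        · subst hij
          rw [CharTwo.add_self_eq_zero] at hab
          rw [evenOddProj_of_mem hab]
          obtain rfl | rfl : i = 0 ∨ i = 1 := by
            clear a b hab
            revert i
            decide
          · simp [tensorEvenProj, tensorEvenIncl,
              evenOddProj_of_mem_of_ne a.2 (show (0 : ZMod 2) ≠ 1 by decide)]
          · simp [tensorEvenProj, tensorEvenIncl,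
              evenOddProj_of_mem_of_ne a.2 (show (1 : ZMod 2) ≠ 0 by decide)]
        · rw [evenOddProj_of_mem_of_ne hab (by rwa [Ne, CharTwo.add_eq_zero])]
          have hproj (k : ZMod 2) :
              evenOddProj Q₁ k a ⊗ₜ[R] evenOddProj Q₂ k b = 0 := by
            by_cases hik : i = k
            · rw [evenOddProj_of_mem_of_ne b.2 (fun hjk => hij (hik.trans hjk.symm)),
                TensorProduct.tmul_zero]
            · rw [evenOddProj_of_mem_of_ne a.2 hik, TensorProduct.zero_tmul]
          simp [tensorEvenProj, tensorEvenIncl, hproj]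

/-- The even part of the Clifford algebra of an orthogonal sum is the sum of the tensor product of
the even parts and the tensor product of the odd parts. -/
noncomputable def evenOddZeroProdEquiv :
    evenOdd (Q₁.prod Q₂) 0 ≃ₗ[R]
      (evenOdd Q₁ 0 ⊗[R] evenOdd Q₂ 0) × (evenOdd Q₁ 1 ⊗[R] evenOdd Q₂ 1) :=
  LinearEquiv.ofLinearMap
    (tensorEvenProj Q₁ Q₂ ∘ₗ (GradedTensorProduct.of R _ _).symm.toLinearMap ∘ₗ
      (ofProd Q₁ Q₂).toLinearMap ∘ₗ (evenOdd (Q₁.prod Q₂) 0).subtype)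
    (evenOddProj (Q₁.prod Q₂) 0 ∘ₗ (toProd Q₁ Q₂).toLinearMap ∘ₗ
      (GradedTensorProduct.of R _ _).toLinearMap ∘ₗ tensorEvenIncl Q₁ Q₂)
    (LinearMap.ext fun x => by
      have hx := LinearMap.congr_fun (tensorEvenProj_comp_tensorEvenIncl Q₁ Q₂) x
      have hinv (y) : ofProd Q₁ Q₂ (toProd Q₁ Q₂ y) = y :=
        AlgHom.congr_fun (ofProd_comp_toProd Q₁ Q₂) y
      simp only [LinearMap.comp_apply, LinearMap.id_apply] at hx
      simp [evenOddProj_zero_toProd, hinv, hx])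
    (LinearMap.ext fun x => by
      have hinv : toProd Q₁ Q₂ (ofProd Q₁ Q₂ x) = x :=
        AlgHom.congr_fun (toProd_comp_ofProd Q₁ Q₂) (x : CliffordAlgebra (Q₁.prod Q₂))
      have hx := evenOddProj_zero_toProd Q₁ Q₂
        ((GradedTensorProduct.of R _ _).symm (ofProd Q₁ Q₂ x))
      rw [GradedTensorProduct.symm_of_of, hinv, evenOddProj_coe] at hx
      simp [← hx])

end Prod

end CliffordAlgebra

/-- **Orthogonal-sum formula for the even Clifford algebra** (Lemma 3.5 of
"Fibrations in complete intersections of quadrics", affine case): the even part of the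
Clifford algebra of an orthogonal sum `Q₁ ⊥ Q₂` is isomorphic, as an `R`-module, to
`(C₀(Q₁) ⊗ C₀(Q₂)) ⊕ (C₁(Q₁) ⊗ C₁(Q₂))`. -/
theorem even_clifford_of_orthogonal_sum
    {R M₁ M₂ : Type*} [CommRing R] [AddCommGroup M₁] [AddCommGroup M₂]
    [Module R M₁] [Module R M₂]
    (Q₁ : QuadraticForm R M₁) (Q₂ : QuadraticForm R M₂) :
    Nonempty ((CliffordAlgebra.evenOdd (Q₁.prod Q₂) 0) ≃ₗ[R]
      ((CliffordAlgebra.evenOdd Q₁ 0 ⊗[R] CliffordAlgebra.evenOdd Q₂ 0) ×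
        (CliffordAlgebra.evenOdd Q₁ 1 ⊗[R] CliffordAlgebra.evenOdd Q₂ 1))) :=
  ⟨CliffordAlgebra.evenOddZeroProdEquiv Q₁ Q₂⟩
end

section
/- Let R be a commutative ring, M' a finitely generated projective R-module, and q' : M' → R a quadratic form such that q'(v) is a unit of R for some v ∈ M'. Let H be the hyperbolic plane over R, the quadratic form on R × R given by H(x, y) = x * y. Then there is an isomorphism of R-algebras between the even Clifford algebra C₀(H ⊥ q') of the orthogonal sum H ⊥ q' on (R × R) × M' and the 2 × 2 matrix algebra Matrix (Fin 2) (Fin 2) over the even Clifford algebra C₀(q'). -/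
open QuadraticMap

open CliffordAlgebra

/-- If `p` commutes with the image of `i : A →ₐ[R] C`, and `X`, `Y` satisfy
`Y l * X k = δ p`, `X k * p = X k` and `∑ k, X k * Y k = 1`, then
`a ↦ ∑ k l, X k * i (a k l) * Y l` is an algebra homomorphism from matrices over `A` to `C`. -/
def Matrix.algHomOfFrame {R A C n : Type*} [CommRing R] [Ring A] [Ring C] [Algebra R A]
    [Algebra R C] [Fintype n] [DecidableEq n] (i : A →ₐ[R] C) (p : C) (X Y : n → C)
    (hp : ∀ a, p * i a = i a * p) (hYX : ∀ l k, Y l * X k = if l = k then p else 0)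
    (hX : ∀ k, X k * p = X k) (hsum : ∑ k, X k * Y k = 1) : Matrix n n A →ₐ[R] C :=
  AlgHom.ofLinearMap
    { toFun := fun a => ∑ k, ∑ l, X k * i (a k l) * Y l
      map_add' := fun a b => by
        simp [mul_add, add_mul, Finset.sum_add_distrib]
      map_smul' := fun r a => by
        simp [Finset.smul_sum] }
    (by
      simp [Matrix.one_apply, apply_ite i, hsum])
    (fun a b => by
      have key (k l l' m : n) : X k * i (a k l) * Y l * (X l' * i (b l' m) * Y m) =
          if l = l' then X k * i (a k l * b l' m) * Y m else 0 := by
        calc _ = X k * i (a k l) * (Y l * X l') * i (b l' m) * Y m := by noncomm_ring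
          _ = _ := by
            rw [hYX]
            split_ifs with h
            · rw [mul_assoc (X k), ← hp, ← mul_assoc, hX, map_mul]
              simp only [mul_assoc]
            · simp
      simp only [LinearMap.coe_mk, AddHom.coe_mk, Matrix.mul_apply, map_sum]
      rw [Finset.sum_mul]
      refine Finset.sum_congr rfl fun k _ => ?_
      rw [Finset.sum_mul]
      simp only [Finset.mul_sum, Finset.sum_mul, key]
      rw [Finset.sum_comm]
      refine Finset.sum_congr rfl fun l _ => ?_
      rw [Finset.sum_comm]
      simp)

theorem Matrix.algHomOfFrame_apply {R A C n : Type*} [CommRing R] [Ring A] [Ring C] [Algebra R A]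
    [Algebra R C] [Fintype n] [DecidableEq n] (i : A →ₐ[R] C) (p : C) (X Y : n → C)
    (hp : ∀ a, p * i a = i a * p) (hYX : ∀ l k, Y l * X k = if l = k then p else 0)
    (hX : ∀ k, X k * p = X k) (hsum : ∑ k, X k * Y k = 1) (a : Matrix n n A) :
    Matrix.algHomOfFrame i p X Y hp hYX hX hsum a = ∑ k, ∑ l, X k * i (a k l) * Y l :=
  rfl

namespace HyperbolicSplit

variable {R M : Type*} [CommRing R] [AddCommGroup M] [Module R M] (q : QuadraticForm R M)

@[simp]
theorem hyperbolicPlane_apply (z : R × R) : hyperbolicPlane R z = z.1 * z.2 := by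
  simp [hyperbolicPlane]

/-- The first isotropic generator of the hyperbolic plane. -/
def e : CliffordAlgebra ((hyperbolicPlane R).prod q) := ι _ ((1, 0), 0)

/-- The second isotropic generator of the hyperbolic plane. -/
def f : CliffordAlgebra ((hyperbolicPlane R).prod q) := ι _ ((0, 1), 0)

/-- The map of Clifford algebras induced by including the second summand. -/
def incl : CliffordAlgebra q →ₐ[R] CliffordAlgebra ((hyperbolicPlane R).prod q) :=
  CliffordAlgebra.map (QuadraticMap.Isometry.inr _ _)

theorem incl_ι (m : M) : incl q (ι q m) = ι _ (0, m) := by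
  simp [incl]

theorem ι_eq (x y : R) (m : M) :
    ι ((hyperbolicPlane R).prod q) ((x, y), m) = x • e q + y • f q + incl q (ι q m) := by
  rw [incl_ι, e, f, ← map_smul, ← map_smul, ← map_add, ← map_add]
  simp

theorem e_mul_e : e q * e q = 0 := by
  simp [e, ι_sq_scalar]

theorem f_mul_f : f q * f q = 0 := by
  simp [f, ι_sq_scalar]

theorem f_mul_e : f q * e q = 1 - e q * f q := by
  rw [eq_sub_iff_add_eq, e, f, ι_mul_ι_add_swap]
  simp [QuadraticMap.polar]

theorem ι_mul_incl (z : R × R) (a : CliffordAlgebra q) :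
    ι ((hyperbolicPlane R).prod q) (z, 0) * incl q a =
      incl q (involute a) * ι ((hyperbolicPlane R).prod q) (z, 0) := by
  induction a using CliffordAlgebra.induction with
  | algebraMap r => simp [Algebra.commutes]
  | ι m =>
    rw [incl_ι, involute_ι, map_neg, incl_ι, neg_mul]
    refine ι_mul_ι_comm_of_isOrtho ?_
    simp [QuadraticMap.IsOrtho]
  | mul a b ha hb => rw [map_mul, ← mul_assoc, ha, mul_assoc, hb, map_mul, map_mul, mul_assoc]
  | add a b ha hb => simp [mul_add, add_mul, ha, hb]

theorem e_mul_incl (a : CliffordAlgebra q) : e q * incl q a = incl q (involute a) * e q :=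
  ι_mul_incl q _ a

theorem f_mul_incl (a : CliffordAlgebra q) : f q * incl q a = incl q (involute a) * f q :=
  ι_mul_incl q _ a

/-- The matrix representation of `CliffordAlgebra (hyperbolicPlane.prod q)`. -/
def toMatrix : CliffordAlgebra ((hyperbolicPlane R).prod q) →ₐ[R]
    Matrix (Fin 2) (Fin 2) (CliffordAlgebra q) :=
  CliffordAlgebra.lift _
    ⟨{ toFun := fun z => !![ι q z.2, algebraMap R _ z.1.1; algebraMap R _ z.1.2, -ι q z.2]
       map_add' := fun a b => by
        simp [neg_add_rev, add_comm]
       map_smul' := fun r a => by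
        simp [Algebra.algebraMap_eq_smul_one, mul_smul] },
      fun z => by
        have h (r : R) : algebraMap R (Matrix (Fin 2) (Fin 2) (CliffordAlgebra q)) r =
            !![algebraMap R _ r, 0; 0, algebraMap R _ r] := by
          ext i j
          fin_cases i <;> fin_cases j <;> simp [Matrix.algebraMap_matrix_apply]
        have hc : ι q z.2 * algebraMap R _ z.1.1 = algebraMap R _ z.1.1 * ι q z.2 :=
          (Algebra.commutes _ _).symm
        have hc' : ι q z.2 * algebraMap R _ z.1.2 = algebraMap R _ z.1.2 * ι q z.2 :=
          (Algebra.commutes _ _).symm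
        simp only [LinearMap.coe_mk, AddHom.coe_mk, h, Matrix.mul_fin_two, ι_sq_scalar, hc, hc',
          mul_neg, neg_mul, neg_neg, add_neg_cancel, ← map_mul, ← map_add, QuadraticMap.prod_apply,
          hyperbolicPlane_apply, mul_comm z.1.2, add_comm (q z.2)]⟩

theorem toMatrix_ι (z : (R × R) × M) : toMatrix q (ι _ z) =
    !![ι q z.2, algebraMap R _ z.1.1; algebraMap R _ z.1.2, -ι q z.2] := by
  simp [toMatrix]

theorem toMatrix_incl (a : CliffordAlgebra q) :
    toMatrix q (incl q a) = !![a, 0; 0, involute a] := by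
  induction a using CliffordAlgebra.induction with
  | algebraMap r =>
    ext i j
    fin_cases i <;> fin_cases j <;> simp [Matrix.algebraMap_matrix_apply]
  | ι m => simp [incl_ι, toMatrix_ι]
  | mul a b ha hb => simp [ha, hb]
  | add a b ha hb => simp [ha, hb]

theorem toMatrix_e : toMatrix q (e q) = !![0, 1; 0, 0] := by
  simp [e, toMatrix_ι]

theorem toMatrix_f : toMatrix q (f q) = !![0, 0; 1, 0] := by
  simp [f, toMatrix_ι]

variable {q} {v w : M}

theorem involute_even (a : even q) : involute (a : CliffordAlgebra q) = a :=
  involute_eq_of_mem_even a.2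

theorem e_mul_f_mul_incl (a : CliffordAlgebra q) :
    e q * f q * incl q a = incl q a * (e q * f q) := by
  rw [mul_assoc, f_mul_incl, ← mul_assoc, e_mul_incl, involute_involute, mul_assoc]

theorem e_mul_f_mul_e : e q * f q * e q = e q := by
  rw [mul_assoc, f_mul_e, mul_sub, ← mul_assoc, e_mul_e]
  simp

theorem f_mul_e_mul_f : f q * (e q * f q) = f q := by
  rw [← mul_assoc, f_mul_e, sub_mul, mul_assoc, f_mul_f]
  simp

variable (q) in
/-- The restriction of `incl` to the even subalgebra. -/
def evenIncl : even q →ₐ[R] CliffordAlgebra ((hyperbolicPlane R).prod q) :=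
  (incl q).comp (even q).val

theorem evenIncl_apply (a : even q) : evenIncl q a = incl q a := rfl

variable (q) in
theorem e_mul_f_mul_evenIncl (a : even q) :
    e q * f q * evenIncl q a = evenIncl q a * (e q * f q) :=
  e_mul_f_mul_incl _

/-- The matrix algebra over the even subalgebra, mapped into the Clifford algebra of the
orthogonal sum with a hyperbolic plane by means of mutually inverse vectors `v` and `w`. -/
noncomputable def ofMatrix (hvw : ι q v * ι q w = 1) (hwv : ι q w * ι q v = 1) :
    Matrix (Fin 2) (Fin 2) (even q) →ₐ[R] CliffordAlgebra ((hyperbolicPlane R).prod q) :=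
  Matrix.algHomOfFrame (evenIncl q) (e q * f q)
    ![e q * f q, f q * incl q (ι q v)] ![e q * f q, incl q (ι q w) * e q]
    (e_mul_f_mul_evenIncl q)
    (fun l k => by
      have h0 : e q * f q * (f q * incl q (ι q v)) = 0 := by
        rw [← mul_assoc, mul_assoc (e q), f_mul_f]; simp
      have h1 : incl q (ι q w) * e q * (e q * f q) = 0 := by
        rw [mul_assoc, ← mul_assoc (e q), e_mul_e]; simp
      have h2 : incl q (ι q w) * e q * (f q * incl q (ι q v)) = e q * f q := by
        rw [mul_assoc, ← mul_assoc (e q), e_mul_f_mul_incl, ← mul_assoc, ← map_mul, hwv]; simp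
      have h3 : e q * f q * (e q * f q) = e q * f q := by
        rw [← mul_assoc, e_mul_f_mul_e]
      fin_cases l <;> fin_cases k <;> simp [h0, h1, h2, h3])
    (fun k => by
      have h3 : e q * f q * (e q * f q) = e q * f q := by
        rw [← mul_assoc, e_mul_f_mul_e]
      have h4 : f q * incl q (ι q v) * (e q * f q) = f q * incl q (ι q v) := by
        rw [mul_assoc, ← e_mul_f_mul_incl, ← mul_assoc, f_mul_e_mul_f]
      fin_cases k <;> simp [h3, h4])
    (by
      have h3 : e q * f q * (e q * f q) = e q * f q := by
        rw [← mul_assoc, e_mul_f_mul_e]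
      have h5 : f q * incl q (ι q v) * (incl q (ι q w) * e q) = 1 - e q * f q := by
        rw [mul_assoc, ← mul_assoc (incl q _), ← map_mul, hvw, map_one, one_mul, f_mul_e]
      simp [Fin.sum_univ_two, h3, h5])

theorem ofMatrix_apply (hvw : ι q v * ι q w = 1) (hwv : ι q w * ι q v = 1)
    (a : Matrix (Fin 2) (Fin 2) (even q)) :
    ofMatrix hvw hwv a =
      incl q (a 0 0) * (e q * f q) + incl q (a 0 1 * ι q w) * e q +
      (f q * incl q (ι q v * a 1 0) + incl q (ι q v * a 1 1 * ι q w) * (f q * e q)) := by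
  have h3 : e q * f q * (e q * f q) = e q * f q := by
    rw [← mul_assoc, e_mul_f_mul_e]
  have h00 : e q * f q * incl q (a 0 0) * (e q * f q) = incl q (a 0 0) * (e q * f q) := by
    rw [e_mul_f_mul_incl, mul_assoc, h3]
  have h01 : e q * f q * incl q (a 0 1) * (incl q (ι q w) * e q) =
      incl q (a 0 1 * ι q w) * e q := by
    rw [← mul_assoc, mul_assoc (e q * f q), ← map_mul, e_mul_f_mul_incl, mul_assoc,
      e_mul_f_mul_e]
  have h10 : f q * incl q (ι q v) * incl q (a 1 0) * (e q * f q) =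
      f q * incl q (ι q v * a 1 0) := by
    rw [mul_assoc (f q), ← map_mul, mul_assoc, ← e_mul_f_mul_incl, ← mul_assoc, f_mul_e_mul_f]
  have h11 : f q * incl q (ι q v) * incl q (a 1 1) * (incl q (ι q w) * e q) =
      incl q (ι q v * a 1 1 * ι q w) * (f q * e q) := by
    rw [mul_assoc (f q), ← map_mul, ← mul_assoc, mul_assoc (f q), ← map_mul, f_mul_incl,
      mul_assoc]
    simp [involute_even]
  rw [ofMatrix, Matrix.algHomOfFrame_apply]
  simp [evenIncl_apply, Fin.sum_univ_two, h00, h01, h10, h11, -map_mul]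

theorem ofMatrix_injective (hvw : ι q v * ι q w = 1) (hwv : ι q w * ι q v = 1) :
    Function.Injective (ofMatrix hvw hwv) := by
  rw [injective_iff_map_eq_zero]
  intro a ha
  have h := congrArg (toMatrix q) ha
  rw [ofMatrix_apply] at h
  simp only [map_add, map_mul (toMatrix q), toMatrix_incl, toMatrix_e, toMatrix_f, map_zero] at h
  have h00 := congrFun (congrFun h 0) 0
  have h01 := congrArg (· * ι q v) (congrFun (congrFun h 0) 1)
  have h10 := congrArg (ι q w * ·) (congrFun (congrFun h 1) 0)
  have h11 := congrArg (ι q w * · * ι q v) (congrFun (congrFun h 1) 1)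
  have cancel (x : CliffordAlgebra q) : ι q w * (ι q v * x) = x := by
    rw [← mul_assoc, hwv, one_mul]
  simp [involute_even, mul_assoc, hwv, cancel] at h00 h01 h10 h11
  ext i j
  fin_cases i <;> fin_cases j <;> simp [h00, h01, h10, h11]

theorem ofMatrix_mem_even (hvw : ι q v * ι q w = 1) (hwv : ι q w * ι q v = 1)
    (a : Matrix (Fin 2) (Fin 2) (even q)) :
    ofMatrix hvw hwv a ∈ even ((hyperbolicPlane R).prod q) := by
  have hi (x : even q) : incl q x ∈ even ((hyperbolicPlane R).prod q) := by
    obtain ⟨x, hx⟩ := x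
    induction x, hx using even_induction with
    | algebraMap r => simp
    | add x y hx hy ihx ihy => simpa using add_mem ihx ihy
    | ι_mul_ι_mul m₁ m₂ x hx ih =>
      simpa only [map_mul, incl_ι] using
        mul_mem (S := Subalgebra R _) (ι_mul_ι_mem_evenOdd_zero _ (0, m₁) (0, m₂)) ih
  have hef : e q * f q ∈ even ((hyperbolicPlane R).prod q) := ι_mul_ι_mem_evenOdd_zero _ _ _
  have hfv : f q * incl q (ι q v) ∈ even ((hyperbolicPlane R).prod q) := by
    rw [incl_ι]
    exact ι_mul_ι_mem_evenOdd_zero _ _ _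
  have hwe : incl q (ι q w) * e q ∈ even ((hyperbolicPlane R).prod q) := by
    rw [incl_ι]
    exact ι_mul_ι_mem_evenOdd_zero _ _ _
  rw [ofMatrix, Matrix.algHomOfFrame_apply]
  refine sum_mem fun k _ => sum_mem fun l _ => mul_mem (mul_mem ?_ (hi _)) ?_
  · fin_cases k <;> assumption
  · fin_cases l <;> assumption

theorem ι_mul_ι_mem_range (hvw : ι q v * ι q w = 1) (hwv : ι q w * ι q v = 1)
    (z z' : (R × R) × M) : ι _ z * ι _ z' ∈ (ofMatrix hvw hwv).range := by
  obtain ⟨⟨x, y⟩, m⟩ := z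
  obtain ⟨⟨x', y'⟩, m'⟩ := z'
  let B := (even.ι q).bilin
  have hB (a b : M) : (B a b : CliffordAlgebra q) = ι q a * ι q b := rfl
  have cancel (c : CliffordAlgebra q) : ι q v * (ι q w * c) = c := by
    rw [← mul_assoc, hvw, one_mul]
  have he (n : M) : e q * incl q (ι q n) = -(incl q (ι q n) * e q) := by
    simp [e_mul_incl]
  have hf (n : M) : incl q (ι q n) * f q = -(f q * incl q (ι q n)) := by
    simp [f_mul_incl]
  refine ⟨!![B m m' + algebraMap R _ (x * y'), x' • B m v - x • B m' v;
    y • B w m' - y' • B w m, algebraMap R _ (y * x') + B w m * B m' v], ?_⟩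
  have hf' (n : M) (c) : incl q (ι q n) * (f q * c) = -(f q * (incl q (ι q n) * c)) := by
    rw [← mul_assoc, hf, neg_mul, mul_assoc]
  have hef : e q * f q = 1 - f q * e q := by rw [f_mul_e, sub_sub_cancel]
  refine (ofMatrix_apply hvw hwv _).trans ?_
  rw [ι_eq, ι_eq]
  simp [hB, mul_add, add_mul, mul_sub, sub_mul, mul_assoc, cancel, hvw,
    Algebra.algebraMap_eq_smul_one, e_mul_e, f_mul_f, he, hf, hf', hef, smul_sub, mul_smul,
    smul_comm x y', smul_comm y x']
  abel

theorem nonempty_algEquiv (h : ∃ v, IsUnit (q v)) :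
    Nonempty (even ((hyperbolicPlane R).prod q) ≃ₐ[R] Matrix (Fin 2) (Fin 2) (even q)) := by
  obtain ⟨v, u, hu⟩ := h
  have hvw : ι q v * ι q ((↑u⁻¹ : R) • v) = 1 := by
    rw [map_smul, mul_smul_comm, ι_sq_scalar, ← hu, Algebra.smul_def, ← map_mul, Units.inv_mul, map_one]
  have hwv : ι q ((↑u⁻¹ : R) • v) * ι q v = 1 := by
    rw [map_smul, smul_mul_assoc, ι_sq_scalar, ← hu, Algebra.smul_def, ← map_mul, Units.inv_mul, map_one]
  refine ⟨(AlgEquiv.ofBijective ((ofMatrix hvw hwv).codRestrict _ (ofMatrix_mem_even hvw hwv))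
    ⟨?_, ?_⟩).symm⟩
  · exact (AlgHom.injective_codRestrict _ _ _).2 (ofMatrix_injective hvw hwv)
  · rintro ⟨x, hx⟩
    suffices x ∈ (ofMatrix hvw hwv).range by
      obtain ⟨a, ha⟩ := this
      exact ⟨a, Subtype.ext ha⟩
    induction x, hx using even_induction with
    | algebraMap r => exact Subalgebra.algebraMap_mem _ r
    | add x y hx hy ihx ihy => exact add_mem ihx ihy
    | ι_mul_ι_mul m₁ m₂ x hx ih => exact mul_mem (ι_mul_ι_mem_range hvw hwv m₁ m₂) ih

end HyperbolicSplit

/-- **Proposition 3.8** of "Fibrations in complete intersections of quadrics"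
(affine, trivial-line-bundle case): if `q'` represents a unit, then the even Clifford
algebra of `H ⊥ q'` is a `2 × 2` matrix algebra over the even Clifford algebra of `q'`. -/
theorem even_clifford_split_hyperbolic_matrix
    {R M' : Type*} [CommRing R] [AddCommGroup M'] [Module R M']
    [Module.Projective R M'] [Module.Finite R M']
    (q' : QuadraticForm R M') (h : ∃ v : M', IsUnit (q' v)) :
    Nonempty ((CliffordAlgebra.even ((hyperbolicPlane R).prod q')) ≃ₐ[R]
      Matrix (Fin 2) (Fin 2) (CliffordAlgebra.even q')) := by
  exact HyperbolicSplit.nonempty_algEquiv h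
end

section
/- Let R be a commutative ring, M' a finitely generated projective R-module, and q' : M' → R a quadratic form such that q'(v) is a unit of R for some v ∈ M'. Let H be the hyperbolic plane over R. Then the center of the even Clifford algebra C₀(H ⊥ q') of the orthogonal sum H ⊥ q' on (R × R) × M' is isomorphic, as an R-algebra, to the center of the even Clifford algebra C₀(q'). -/
open QuadraticMap

open CliffordAlgebra

section HyperbolicSplitting

variable {R M : Type*} [CommRing R] [AddCommGroup M] [Module R M] (q : QuadraticForm R M)

theorem hyperbolicPlane_apply (x : R × R) : hyperbolicPlane R x = x.1 * x.2 := rfl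

/-- The vector `((x, y), m)` of `H ⊥ q` as the matrix `!![m, x; y, -m]` over the Clifford
algebra of `q`. -/
noncomputable def hyperbolicProdToMatrixAux :
    ((R × R) × M) →ₗ[R] Matrix (Fin 2) (Fin 2) (CliffordAlgebra q) where
  toFun x := !![ι q x.2, algebraMap R _ x.1.1; algebraMap R _ x.1.2, -ι q x.2]
  map_add' x y := by
    ext i j; fin_cases i <;> fin_cases j <;> simp [add_comm]
  map_smul' r x := by
    ext i j; fin_cases i <;> fin_cases j <;> simp [Algebra.smul_def]

/-- The representation of the Clifford algebra of `H ⊥ q` by `2 × 2` matrices over the Clifford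
algebra of `q`. -/
noncomputable def hyperbolicProdToMatrix :
    CliffordAlgebra ((hyperbolicPlane R).prod q) →ₐ[R]
      Matrix (Fin 2) (Fin 2) (CliffordAlgebra q) :=
  CliffordAlgebra.lift _ ⟨hyperbolicProdToMatrixAux q, fun x => by
    ext i j
    fin_cases i <;> fin_cases j <;>
      simp [hyperbolicProdToMatrixAux, Matrix.mul_apply, Matrix.algebraMap_matrix_apply,
        hyperbolicPlane_apply, add_comm, Algebra.commutes x.1.1 (ι q x.2),
        Algebra.commutes x.1.2 (ι q x.2),
        Algebra.commutes x.1.2 (algebraMap R (CliffordAlgebra q) x.1.1)]⟩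

theorem hyperbolicProdToMatrix_ι (x : (R × R) × M) :
    hyperbolicProdToMatrix q (ι _ x) =
      !![ι q x.2, algebraMap R _ x.1.1; algebraMap R _ x.1.2, -ι q x.2] := by
  simp [hyperbolicProdToMatrix, hyperbolicProdToMatrixAux]

/-- The inclusion of the Clifford algebra of `q` into that of `H ⊥ q`. -/
noncomputable abbrev inrHyperbolicProd :
    CliffordAlgebra q →ₐ[R] CliffordAlgebra ((hyperbolicPlane R).prod q) :=
  CliffordAlgebra.map (QuadraticMap.Isometry.inr (hyperbolicPlane R) q)

/-- The first isotropic generator of the hyperbolic plane. -/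
noncomputable abbrev hyperbolicFst : CliffordAlgebra ((hyperbolicPlane R).prod q) :=
  ι _ ((1, 0), 0)

/-- The second isotropic generator of the hyperbolic plane. -/
noncomputable abbrev hyperbolicSnd : CliffordAlgebra ((hyperbolicPlane R).prod q) :=
  ι _ ((0, 1), 0)

theorem hyperbolicFst_mul_self : hyperbolicFst q * hyperbolicFst q = 0 := by
  simp [hyperbolicPlane_apply]

theorem hyperbolicSnd_mul_self : hyperbolicSnd q * hyperbolicSnd q = 0 := by
  simp [hyperbolicPlane_apply]

theorem hyperbolicSnd_mul_hyperbolicFst :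
    hyperbolicSnd q * hyperbolicFst q = 1 - hyperbolicFst q * hyperbolicSnd q := by
  rw [eq_sub_iff_add_eq, ι_mul_ι_add_swap]
  simp [polar, hyperbolicPlane_apply]

theorem inr_mul_hyperbolicFst (m : M) :
    ι ((hyperbolicPlane R).prod q) (0, m) * hyperbolicFst q =
      -(hyperbolicFst q * ι _ (0, m)) := by
  rw [ι_mul_ι_comm_of_isOrtho]
  simp [isOrtho_def, hyperbolicPlane_apply]

theorem inr_mul_hyperbolicSnd (m : M) :
    ι ((hyperbolicPlane R).prod q) (0, m) * hyperbolicSnd q =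
      -(hyperbolicSnd q * ι _ (0, m)) := by
  rw [ι_mul_ι_comm_of_isOrtho]
  simp [isOrtho_def, hyperbolicPlane_apply]

theorem ι_hyperbolicProd (x : (R × R) × M) :
    ι ((hyperbolicPlane R).prod q) x =
      x.1.1 • hyperbolicFst q + x.1.2 • hyperbolicSnd q + ι _ (0, x.2) := by
  rw [← map_smul, ← map_smul, ← map_add, ← map_add]
  congr 1
  ext <;> simp

/-- A left inverse of `hyperbolicProdToMatrix`, as a function. -/
noncomputable def hyperbolicProdOfMatrix (N : Matrix (Fin 2) (Fin 2) (CliffordAlgebra q)) :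
    CliffordAlgebra ((hyperbolicPlane R).prod q) :=
  hyperbolicFst q * hyperbolicSnd q * inrHyperbolicProd q (N 0 0) +
    hyperbolicFst q * inrHyperbolicProd q (involute (N 0 1)) +
    hyperbolicSnd q * inrHyperbolicProd q (N 1 0) +
    hyperbolicSnd q * hyperbolicFst q * inrHyperbolicProd q (involute (N 1 1))

theorem hyperbolicProdOfMatrix_add (N N' : Matrix (Fin 2) (Fin 2) (CliffordAlgebra q)) :
    hyperbolicProdOfMatrix q (N + N') =
      hyperbolicProdOfMatrix q N + hyperbolicProdOfMatrix q N' := by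
  simp only [hyperbolicProdOfMatrix, Matrix.add_apply, map_add, mul_add]
  abel

theorem hyperbolicProdOfMatrix_ι_mul (x : (R × R) × M)
    (N : Matrix (Fin 2) (Fin 2) (CliffordAlgebra q)) :
    hyperbolicProdOfMatrix q (hyperbolicProdToMatrix q (ι _ x) * N) =
      ι _ x * hyperbolicProdOfMatrix q N := by
  have hee := hyperbolicFst_mul_self q
  have hff := hyperbolicSnd_mul_self q
  have hfe := hyperbolicSnd_mul_hyperbolicFst q
  have hme := inr_mul_hyperbolicFst q x.2
  have hmf := inr_mul_hyperbolicSnd q x.2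
  rw [hyperbolicProdToMatrix_ι, ι_hyperbolicProd]
  simp only [hyperbolicProdOfMatrix, Matrix.mul_apply, Fin.sum_univ_two, Matrix.of_apply,
    Matrix.cons_val_zero, Matrix.cons_val_one, Matrix.cons_val', Matrix.cons_val_fin_one,
    map_add, map_mul, map_neg, map_smul, involute_ι, map_apply_ι, QuadraticMap.Isometry.inr_apply,
    ← Algebra.smul_def]
  generalize hyperbolicFst q = e at *
  generalize hyperbolicSnd q = f at *
  generalize ι ((hyperbolicPlane R).prod q) (0, x.2) = m at *
  have hee' (z) : e * (e * z) = 0 := by rw [← mul_assoc, hee, zero_mul]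
  have hff' (z) : f * (f * z) = 0 := by rw [← mul_assoc, hff, zero_mul]
  have hfe' (z) : f * (e * z) = z - e * (f * z) := by
    rw [← mul_assoc, hfe, sub_mul, one_mul, mul_assoc]
  have hme' (z) : m * (e * z) = -(e * (m * z)) := by
    rw [← mul_assoc, hme, neg_mul, mul_assoc]
  have hmf' (z) : m * (f * z) = -(f * (m * z)) := by
    rw [← mul_assoc, hmf, neg_mul, mul_assoc]
  simp only [mul_add, add_mul, mul_assoc, smul_mul_assoc, mul_smul_comm, hee', hff', hfe', hme',
    hmf', mul_neg, neg_mul, neg_neg, mul_sub, smul_sub, smul_zero, sub_zero,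
    mul_zero]
  abel

theorem hyperbolicProdOfMatrix_toMatrix_mul
    (x : CliffordAlgebra ((hyperbolicPlane R).prod q)) :
    ∀ N, hyperbolicProdOfMatrix q (hyperbolicProdToMatrix q x * N) =
      x * hyperbolicProdOfMatrix q N := by
  induction x using CliffordAlgebra.induction with
  | algebraMap r =>
    intro N
    simp only [AlgHom.commutes, ← Algebra.smul_def]
    simp [hyperbolicProdOfMatrix, smul_add]
  | ι x => exact hyperbolicProdOfMatrix_ι_mul q x
  | mul a b ha hb => intro N; rw [map_mul, mul_assoc, ha, hb, mul_assoc]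
  | add a b ha hb => intro N; rw [map_add, add_mul, hyperbolicProdOfMatrix_add, ha, hb, add_mul]

theorem hyperbolicProdToMatrix_injective : Function.Injective (hyperbolicProdToMatrix q) := by
  refine Function.LeftInverse.injective (g := hyperbolicProdOfMatrix q) fun x => ?_
  have h := hyperbolicProdOfMatrix_toMatrix_mul q x 1
  rw [mul_one] at h
  rw [h]
  simp [hyperbolicProdOfMatrix, hyperbolicSnd_mul_hyperbolicFst]

variable {q} in
theorem mul_mem_evenOdd {i j k : ZMod 2} (hk : i + j = k) {x y : CliffordAlgebra q}
    (hx : x ∈ evenOdd q i) (hy : y ∈ evenOdd q j) : x * y ∈ evenOdd q k :=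
  hk ▸ SetLike.mul_mem_graded hx hy

/-- Multiplication by the matrix of a vector exchanges the parities of the entries. -/
theorem hyperbolicProdToMatrix_ι_mul_mem_evenOdd (x : (R × R) × M) {i j : ZMod 2}
    (hij : 1 + i = j) (hji : 1 + j = i) {N : Matrix (Fin 2) (Fin 2) (CliffordAlgebra q)}
    (h : N 0 0 ∈ evenOdd q i ∧ N 0 1 ∈ evenOdd q j ∧ N 1 0 ∈ evenOdd q j ∧
      N 1 1 ∈ evenOdd q i) :
    (hyperbolicProdToMatrix q (ι _ x) * N) 0 0 ∈ evenOdd q j ∧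
    (hyperbolicProdToMatrix q (ι _ x) * N) 0 1 ∈ evenOdd q i ∧
    (hyperbolicProdToMatrix q (ι _ x) * N) 1 0 ∈ evenOdd q i ∧
    (hyperbolicProdToMatrix q (ι _ x) * N) 1 1 ∈ evenOdd q j := by
  obtain ⟨h₀₀, h₀₁, h₁₀, h₁₁⟩ := h
  have hm := ι_mem_evenOdd_one q x.2
  simp only [hyperbolicProdToMatrix_ι, Matrix.mul_apply, Fin.sum_univ_two, Matrix.of_apply,
    Matrix.cons_val_zero, Matrix.cons_val_one, Matrix.cons_val', Matrix.cons_val_fin_one,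
    ← Algebra.smul_def, neg_mul]
  exact ⟨add_mem (mul_mem_evenOdd hij hm h₀₀) (Submodule.smul_mem _ _ h₁₀),
    add_mem (mul_mem_evenOdd hji hm h₀₁) (Submodule.smul_mem _ _ h₁₁),
    add_mem (Submodule.smul_mem _ _ h₀₀) (neg_mem (mul_mem_evenOdd hji hm h₁₀)),
    add_mem (Submodule.smul_mem _ _ h₀₁) (neg_mem (mul_mem_evenOdd hij hm h₁₁))⟩

theorem hyperbolicProdToMatrix_apply_mem_evenOdd
    {x : CliffordAlgebra ((hyperbolicPlane R).prod q)} (hx : x ∈ evenOdd _ 0) :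
    hyperbolicProdToMatrix q x 0 0 ∈ evenOdd q 0 ∧ hyperbolicProdToMatrix q x 0 1 ∈ evenOdd q 1 ∧
    hyperbolicProdToMatrix q x 1 0 ∈ evenOdd q 1 ∧
    hyperbolicProdToMatrix q x 1 1 ∈ evenOdd q 0 := by
  induction x, hx using even_induction with
  | algebraMap r =>
    have hr : algebraMap R (CliffordAlgebra q) r ∈ evenOdd q 0 := (even q).algebraMap_mem r
    simpa [Matrix.algebraMap_matrix_apply] using hr
  | add x y hx hy ihx ihy =>
    simp only [map_add, Matrix.add_apply]
    exact ⟨add_mem ihx.1 ihy.1, add_mem ihx.2.1 ihy.2.1, add_mem ihx.2.2.1 ihy.2.2.1,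
      add_mem ihx.2.2.2 ihy.2.2.2⟩
  | ι_mul_ι_mul x y z hz ih =>
    rw [map_mul, map_mul, mul_assoc]
    exact hyperbolicProdToMatrix_ι_mul_mem_evenOdd q x (by decide) (by decide)
      (hyperbolicProdToMatrix_ι_mul_mem_evenOdd q y (by decide) (by decide) ih)

theorem hyperbolicProdToMatrix_inr {x : CliffordAlgebra q} (hx : x ∈ evenOdd q 0) :
    hyperbolicProdToMatrix q (inrHyperbolicProd q x) = !![x, 0; 0, x] := by
  induction x, hx using even_induction with
  | algebraMap r =>
    simp only [AlgHom.commutes]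
    ext i j
    fin_cases i <;> fin_cases j <;> simp [Matrix.algebraMap_matrix_apply]
  | add x y hx hy ihx ihy => simp [ihx, ihy]
  | ι_mul_ι_mul m₁ m₂ x hx ih =>
    simp [ih, hyperbolicProdToMatrix_ι, mul_assoc]

theorem inrHyperbolicProd_mem_even {x : CliffordAlgebra q} (hx : x ∈ evenOdd q 0) :
    inrHyperbolicProd q x ∈ even ((hyperbolicPlane R).prod q) := by
  induction x, hx using even_induction with
  | algebraMap r =>
    rw [AlgHom.commutes]
    exact Subalgebra.algebraMap_mem _ r
  | add x y hx hy ihx ihy =>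
    rw [map_add]
    exact add_mem ihx ihy
  | ι_mul_ι_mul m₁ m₂ x hx ih =>
    rw [map_mul, map_mul, map_apply_ι, map_apply_ι]
    exact mul_mem (ι_mul_ι_mem_evenOdd_zero _ _ _) ih

/-- Every diagonal matrix with even entries represents an even element. -/
theorem exists_mem_even_hyperbolicProdToMatrix_eq {a d : CliffordAlgebra q}
    (ha : a ∈ evenOdd q 0) (hd : d ∈ evenOdd q 0) :
    ∃ x ∈ even ((hyperbolicPlane R).prod q), hyperbolicProdToMatrix q x = !![a, 0; 0, d] := by
  refine ⟨hyperbolicFst q * hyperbolicSnd q * inrHyperbolicProd q a +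
    hyperbolicSnd q * hyperbolicFst q * inrHyperbolicProd q d,
    add_mem (mul_mem (ι_mul_ι_mem_evenOdd_zero _ _ _) (inrHyperbolicProd_mem_even q ha))
      (mul_mem (ι_mul_ι_mem_evenOdd_zero _ _ _) (inrHyperbolicProd_mem_even q hd)), ?_⟩
  simp only [map_add, map_mul, hyperbolicProdToMatrix_inr q ha, hyperbolicProdToMatrix_inr q hd,
    hyperbolicProdToMatrix_ι]
  simp

variable {q}

/-- A central element of the even Clifford algebra of `H ⊥ q` is represented by a diagonal
matrix, whose entries are intertwined by every vector. -/
theorem hyperbolicProdToMatrix_of_mem_center {z : even ((hyperbolicPlane R).prod q)}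
    (hz : z ∈ Subalgebra.center R (even ((hyperbolicPlane R).prod q))) :
    hyperbolicProdToMatrix q z 0 1 = 0 ∧ hyperbolicProdToMatrix q z 1 0 = 0 ∧
    (∀ c ∈ evenOdd q 0,
      c * hyperbolicProdToMatrix q z 0 0 = hyperbolicProdToMatrix q z 0 0 * c) ∧
    ∀ m, ι q m * hyperbolicProdToMatrix q z 1 1 = hyperbolicProdToMatrix q z 0 0 * ι q m := by
  rw [Subalgebra.mem_center_iff] at hz
  have key (x) (hx : x ∈ even ((hyperbolicPlane R).prod q)) :
      hyperbolicProdToMatrix q x * hyperbolicProdToMatrix q z =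
        hyperbolicProdToMatrix q z * hyperbolicProdToMatrix q x := by
    rw [← map_mul, ← map_mul]
    exact congrArg _ (congrArg Subtype.val (hz ⟨x, hx⟩))
  have diag {c : CliffordAlgebra q} (hc : c ∈ evenOdd q 0) :
      !![c, 0; 0, 0] * hyperbolicProdToMatrix q z =
        hyperbolicProdToMatrix q z * !![c, 0; 0, 0] := by
    obtain ⟨x, hx, hxc⟩ := exists_mem_even_hyperbolicProdToMatrix_eq q hc (zero_mem _)
    rw [← hxc, key x hx]
  have h1 := diag (one_mem (even q))
  refine ⟨?_, ?_, fun c hc => ?_, fun m => ?_⟩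
  · simpa [Matrix.mul_apply] using congrFun (congrFun h1 0) 1
  · simpa [Matrix.mul_apply] using (congrFun (congrFun h1 1) 0).symm
  · simpa [Matrix.mul_apply] using congrFun (congrFun (diag hc) 0) 0
  · have h := congrFun (congrFun (key _ (ι_mul_ι_mem_evenOdd_zero _ ((1, 0), 0) (0, m))) 0) 1
    simpa [hyperbolicProdToMatrix_ι, Matrix.mul_apply] using h

variable (q) in
/-- The upper left matrix entry, from the center of the even Clifford algebra of `H ⊥ q` to the
center of that of `q`. -/
noncomputable def centerEvenHyperbolicProdHom :
    Subalgebra.center R (even ((hyperbolicPlane R).prod q)) →ₐ[R]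
      Subalgebra.center R (even q) where
  toFun z := ⟨⟨hyperbolicProdToMatrix q z.1 0 0,
      (hyperbolicProdToMatrix_apply_mem_evenOdd q z.1.2).1⟩,
    Subalgebra.mem_center_iff.2 fun c =>
      Subtype.ext ((hyperbolicProdToMatrix_of_mem_center z.2).2.2.1 c c.2)⟩
  map_one' := by ext; simp
  map_mul' z w := by
    ext
    simp [Matrix.mul_apply, (hyperbolicProdToMatrix_of_mem_center z.2).1]
  map_zero' := by ext; simp
  map_add' z w := by ext; simp
  commutes' r := by ext; simp [Matrix.algebraMap_matrix_apply]

theorem centerEvenHyperbolicProdHom_injective {v : M} (hv : IsUnit (q v)) :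
    Function.Injective (centerEvenHyperbolicProdHom q) := by
  intro z w hzw
  have h₀₀ : hyperbolicProdToMatrix q z.1 0 0 = hyperbolicProdToMatrix q w.1 0 0 :=
    congrArg (fun a => a.1.1) hzw
  obtain ⟨hz₀₁, hz₁₀, -, hz⟩ := hyperbolicProdToMatrix_of_mem_center z.2
  obtain ⟨hw₀₁, hw₁₀, -, hw⟩ := hyperbolicProdToMatrix_of_mem_center w.2
  have h₁₁ : hyperbolicProdToMatrix q z.1 1 1 = hyperbolicProdToMatrix q w.1 1 1 :=
    (isUnit_ι_of_isUnit (Q := q) hv).mul_left_cancel (by rw [hz, hw, h₀₀])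
  refine Subtype.ext (Subtype.ext (hyperbolicProdToMatrix_injective q ?_))
  ext i j
  fin_cases i <;> fin_cases j
  · exact h₀₀
  · exact hz₀₁.trans hw₀₁.symm
  · exact hz₁₀.trans hw₁₀.symm
  · exact h₁₁

theorem centerEvenHyperbolicProdHom_surjective {v : M} (hv : IsUnit (q v)) :
    Function.Surjective (centerEvenHyperbolicProdHom q) := by
  rintro ⟨⟨a, ha⟩, hac⟩
  rw [Subalgebra.mem_center_iff] at hac
  replace hac (c) (hc : c ∈ evenOdd q 0) : c * a = a * c :=
    congrArg Subtype.val (hac ⟨c, hc⟩)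
  obtain ⟨u, hu⟩ := isUnit_ι_of_isUnit (Q := q) hv
  have hu_odd : (u : CliffordAlgebra q) ∈ evenOdd q 1 := hu ▸ ι_mem_evenOdd_one q v
  have hui_odd : (↑u⁻¹ : CliffordAlgebra q) ∈ evenOdd q 1 := by
    obtain ⟨k, hk⟩ := hv
    have : (↑u⁻¹ : CliffordAlgebra q) = (↑k⁻¹ : R) • ι q v := by
      rw [Units.inv_eq_of_mul_eq_one_right]
      rw [hu, mul_smul_comm, ι_sq_scalar, ← hk, Algebra.smul_def, ← map_mul, Units.inv_mul,
        map_one]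
    rw [this]
    exact Submodule.smul_mem _ _ (ι_mem_evenOdd_one q v)
  have odd_mul_odd {b c : CliffordAlgebra q} (hb : b ∈ evenOdd q 1) (hc : c ∈ evenOdd q 1) :
      b * c ∈ evenOdd q 0 := mul_mem_evenOdd (by decide) hb hc
  have odd_mul_even {b c : CliffordAlgebra q} (hb : b ∈ evenOdd q 1) (hc : c ∈ evenOdd q 0) :
      b * c ∈ evenOdd q 1 := mul_mem_evenOdd (by decide) hb hc
  have hd : ↑u⁻¹ * a * u ∈ evenOdd q 0 := odd_mul_odd (odd_mul_even hui_odd ha) hu_odd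
  obtain ⟨x, hx, hxa⟩ := exists_mem_even_hyperbolicProdToMatrix_eq q ha hd
  refine ⟨⟨⟨x, hx⟩, Subalgebra.mem_center_iff.2 fun y => Subtype.ext
    (hyperbolicProdToMatrix_injective q ?_)⟩, ?_⟩
  · obtain ⟨h₀₀, h₀₁, h₁₀, h₁₁⟩ := hyperbolicProdToMatrix_apply_mem_evenOdd q y.2
    simp only [MulMemClass.coe_mul, map_mul, hxa]
    generalize hyperbolicProdToMatrix q y = N at *
    have e₀₁ : N 0 1 * (↑u⁻¹ * a * u) = a * N 0 1 := by
      rw [← mul_assoc, ← mul_assoc, hac _ (odd_mul_odd h₀₁ hui_odd), mul_assoc, mul_assoc,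
        Units.inv_mul, mul_one]
    have e₁₀ : N 1 0 * a = ↑u⁻¹ * a * u * N 1 0 := by
      rw [mul_assoc, mul_assoc, ← hac _ (odd_mul_odd hu_odd h₁₀), mul_assoc,
        Units.inv_mul_cancel_left]
    have e₁₁ : N 1 1 * (↑u⁻¹ * a * u) = ↑u⁻¹ * a * u * N 1 1 := by
      have h := hac _ (odd_mul_odd (odd_mul_even hu_odd h₁₁) hui_odd)
      rw [← Units.mul_right_inj u, ← Units.mul_left_inj u⁻¹]
      simpa [mul_assoc] using h
    ext i j
    fin_cases i <;> fin_cases j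
    · simpa [Matrix.mul_apply] using hac _ h₀₀
    · simpa [Matrix.mul_apply] using e₀₁
    · simpa [Matrix.mul_apply] using e₁₀
    · simpa [Matrix.mul_apply] using e₁₁
  · ext
    simp [centerEvenHyperbolicProdHom, hxa]

end HyperbolicSplitting

/-- **Proposition 3.8** of "Fibrations in complete intersections of quadrics"
(final assertion, affine case): splitting off a hyperbolic plane does not change the
center of the even Clifford algebra. -/
theorem center_even_clifford_split_hyperbolic
    {R M' : Type*} [CommRing R] [AddCommGroup M'] [Module R M']
    [Module.Projective R M'] [Module.Finite R M']
    (q' : QuadraticForm R M') (h : ∃ v : M', IsUnit (q' v)) :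
    Nonempty ((Subalgebra.center R (CliffordAlgebra.even ((hyperbolicPlane R).prod q'))) ≃ₐ[R]
      (Subalgebra.center R (CliffordAlgebra.even q'))) := by
  obtain ⟨v, hv⟩ := h
  exact ⟨AlgEquiv.ofBijective (centerEvenHyperbolicProdHom q')
    ⟨centerEvenHyperbolicProdHom_injective hv, centerEvenHyperbolicProdHom_surjective hv⟩⟩
end

section
/- Let R be a commutative ring, M an R-module, and q : M → R a quadratic form such that q(v) is a unit of R for some v ∈ M. Then, inside the Clifford algebra CliffordAlgebra q, the product of the odd part with itself equals the even part: (evenOdd q 1) * (evenOdd q 1) = evenOdd q 0 as submodules of CliffordAlgebra q. -/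
/-- **Proposition B.2(2)** of "Fibrations in complete intersections of quadrics"
(surjectivity content, affine case): if the quadratic form `q` represents a unit, then
inside the Clifford algebra the product of the odd part with itself is the even part. -/
theorem odd_mul_odd_eq_even
    {R M : Type*} [CommRing R] [AddCommGroup M] [Module R M]
    (q : QuadraticForm R M) (h : ∃ v : M, IsUnit (q v)) :
    CliffordAlgebra.evenOdd q 1 * CliffordAlgebra.evenOdd q 1 =
      CliffordAlgebra.evenOdd q 0 := by
  refine le_antisymm (CliffordAlgebra.evenOdd_mul_le q 1 1) fun x hx => ?_
  obtain ⟨v, u, hu⟩ := h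
  have hv := CliffordAlgebra.ι_mem_evenOdd_one q v
  have hvx : CliffordAlgebra.ι q v * x ∈ CliffordAlgebra.evenOdd q 1 :=
    CliffordAlgebra.evenOdd_mul_le q 1 0 (Submodule.mul_mem_mul hv hx)
  have key : x = (↑u⁻¹ : R) • (CliffordAlgebra.ι q v * (CliffordAlgebra.ι q v * x)) := by
    rw [← mul_assoc, CliffordAlgebra.ι_sq_scalar, ← Algebra.smul_def, smul_smul, ← hu,
      Units.inv_mul, one_smul]
  rw [key]
  exact Submodule.smul_mem _ _ (Submodule.mul_mem_mul hv hvx)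
end

section
/- Let k be a field of characteristic different from 2, V a finite-dimensional k-vector space, and q₁, q₂ : V → k two quadratic forms. Then there exists a nonzero vector v ∈ V with q₁(v) = 0 and q₂(v) = 0 if and only if the quadratic form q₁ + t·q₂ over the rational function field k(t), i.e. the form (q₁).baseChange(k(t)) + X • (q₂).baseChange(k(t)) on k(t) ⊗[k] V, is isotropic (has a nonzero zero). -/
open TensorProduct

open Polynomial in
/-- A quadratic form over `k[X]` in finitely many variables whose values at constant vectors have
degree at most one is isotropic at a constant vector as soon as it is isotropic. -/
theorem QuadraticMap.exists_const_isotropic {k ι : Type*} [Field k] [Fintype ι]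
    (Q : QuadraticForm k[X] (ι → k[X]))
    (hQ : ∀ c : ι → k, (Q fun i => C (c i)).natDegree ≤ 1) (n : ℕ) (v : ι → k[X]) (hv : v ≠ 0)
    (hn : ∀ i, (v i).natDegree ≤ n) (hQv : Q v = 0) :
    ∃ c : ι → k, c ≠ 0 ∧ (Q fun i => C (c i)) = 0 := by
  classical
  induction n generalizing v with
  | zero =>
    have h : v = fun i => C ((v i).coeff 0) :=
      funext fun i => eq_C_of_natDegree_le_zero (hn i)
    refine ⟨fun i => (v i).coeff 0, fun h0 => hv ?_, h ▸ hQv⟩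
    rw [h]
    funext i
    simpa using congrArg C (congrFun h0 i)
  | succ n ih =>
    set c : ι → k := fun i => (v i).coeff 0 with hc
    set e : ι → k[X] := fun i => C (c i) with he
    set u : ι → k[X] := fun i => (v i).divX with hu
    have hvu : v = (X : k[X]) • u + e := by
      funext i
      simp [hu, he, hc, X_mul_divX_add]
    have hun : ∀ i, (u i).natDegree ≤ n := fun i => by
      have := hn i
      simp only [hu, natDegree_divX_eq_natDegree_tsub_one]
      omega
    by_cases hc0 : c = 0
    · have he0 : e = 0 := by
        funext i
        simp [he, hc0]
      rw [he0, add_zero] at hvu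
      refine ih u (fun h => hv (by rw [hvu, h, smul_zero])) hun ?_
      rw [hvu, QuadraticMap.map_smul, smul_eq_mul] at hQv
      simpa using hQv
    by_cases hQe : Q e = 0
    · exact ⟨c, hc0, hQe⟩
    have hee : e = v - (X : k[X]) • u := by rw [hvu]; abel
    have hvv : QuadraticMap.polar Q v v = 0 := by simp [hQv]
    have hpe : QuadraticMap.polar Q v e = - X * QuadraticMap.polar Q v u := by
      rw [hee, QuadraticMap.polar_sub_right, QuadraticMap.polar_smul_right, hvv]
      simp
    have hqe : Q e = X ^ 2 * Q u - X * QuadraticMap.polar Q v u := by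
      rw [hee, sub_eq_add_neg, QuadraticMap.map_add Q, QuadraticMap.polar_neg_right,
        QuadraticMap.map_neg, QuadraticMap.polar_smul_right, QuadraticMap.map_smul, hQv]
      simp only [smul_eq_mul]
      ring
    have hQw : ∀ y : ι → k[X], Q (Q y • v - QuadraticMap.polar Q v y • y) = 0 := fun y => by
      rw [sub_eq_add_neg, QuadraticMap.map_add Q, QuadraticMap.polar_neg_right,
        QuadraticMap.map_neg, QuadraticMap.polar_smul_right, QuadraticMap.polar_smul_left,
        QuadraticMap.map_smul, QuadraticMap.map_smul, hQv]
      simp only [smul_eq_mul]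
      ring
    set w := Q u • v - QuadraticMap.polar Q v u • u with hw
    have hXw : (X ^ 2 : k[X]) • w = Q e • v - QuadraticMap.polar Q v e • e := by
      rw [hpe, hqe, hw, hee]
      module
    have hpoldeg : (QuadraticMap.polar Q v e).natDegree ≤ n + 2 := by
      have hsum : v = ∑ i, v i • fun j => C ((Pi.single i 1 : ι → k) j) := by
        funext j
        simp [Finset.sum_apply, Pi.single_apply]
      have : QuadraticMap.polar Q v e =
          ∑ i, v i * QuadraticMap.polar Q (fun j => C ((Pi.single i 1 : ι → k) j)) e := by
        conv_lhs => rw [hsum]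
        simp only [← QuadraticMap.polarBilin_apply_apply, map_sum, map_smul,
          LinearMap.sum_apply, LinearMap.smul_apply, smul_eq_mul]
      rw [this]
      refine natDegree_sum_le_of_forall_le _ _ fun i _ => ?_
      refine natDegree_mul_le_of_le (m := n + 1) (n := 1) (hn i) ?_
      refine (natDegree_sub_le_of_le (natDegree_sub_le_of_le (m := 1) ?_ (hQ _)) (hQ c)).trans
        (by simp)
      have := hQ (Pi.single i 1 + c)
      simpa only [Pi.add_apply, C_add] using! this
    refine ih w (fun h0 => ?_) (fun i => ?_) (hQw u)
    · rw [h0, smul_zero, eq_comm, sub_eq_zero] at hXw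
      have h := congrArg Q hXw
      rw [QuadraticMap.map_smul, QuadraticMap.map_smul, hQv, smul_zero, eq_comm, smul_eq_mul,
        mul_eq_zero, or_iff_left hQe, mul_self_eq_zero] at h
      rw [h, zero_smul, smul_eq_zero, or_iff_right hQe] at hXw
      exact hv hXw
    · by_cases hwi : w i = 0
      · simp [hwi]
      have h1 : (X ^ 2 * w i).natDegree ≤ n + 2 := by
        have := congrFun hXw i
        simp only [Pi.smul_apply, Pi.sub_apply, smul_eq_mul] at this
        rw [this, ← max_self (n + 2)]
        refine natDegree_sub_le_of_le ?_ ?_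
        · exact (natDegree_mul_le_of_le (hQ c) (hn i)).trans (by omega)
        · exact (natDegree_mul_le_of_le hpoldeg (natDegree_C _).le).trans (by omega)
      rw [natDegree_X_pow_mul _ hwi] at h1
      omega

/-- Base change of quadratic forms is compatible with towers of scalars. -/
theorem QuadraticForm.baseChange_map_algebraMap {k R K V : Type*} [CommRing k]
    [Invertible (2 : k)] [CommRing R] [CommRing K] [Algebra k R] [Algebra R K] [Algebra k K]
    [IsScalarTower k R K] [AddCommGroup V] [Module k V] (q : QuadraticForm k V) (x : R ⊗[k] V) :
    q.baseChange K
        (AlgebraTensorModule.map (Algebra.linearMap R K) (LinearMap.id : V →ₗ[k] V) x) =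
      algebraMap R K (q.baseChange R x) := by
  have h : ((q.baseChange K).restrictScalars (S := R)).comp
        (AlgebraTensorModule.map (Algebra.linearMap R K) (LinearMap.id : V →ₗ[k] V)) =
      (Algebra.linearMap R K).compQuadraticMap (q.baseChange R) := by
    ext m
    simp [← Algebra.algebraMap_eq_smul_one, ← IsScalarTower.algebraMap_apply]
  exact DFunLike.congr_fun h x

/-- Denominators can be cleared in a base change to a localization. -/
theorem IsLocalization.exists_smul_eq_map_algebraMap {k R K V : Type*} [CommRing k] [CommRing R]
    [CommRing K] [Algebra k R] [Algebra R K] [Algebra k K] [IsScalarTower k R K]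
    (S : Submonoid R) [IsLocalization S K] [AddCommGroup V] [Module k V] (y : K ⊗[k] V) :
    ∃ d : S, ∃ x : R ⊗[k] V,
      AlgebraTensorModule.map (Algebra.linearMap R K) (LinearMap.id : V →ₗ[k] V) x =
        algebraMap R K d • y := by
  induction y with
  | zero => exact ⟨1, 0, by simp⟩
  | tmul a v =>
    obtain ⟨⟨r, d⟩, h⟩ := IsLocalization.surj S a
    refine ⟨d, r ⊗ₜ v, ?_⟩
    simp [smul_tmul', ← h, Algebra.smul_def, mul_comm]
  | add y₁ y₂ h₁ h₂ =>
    obtain ⟨d₁, x₁, h₁⟩ := h₁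
    obtain ⟨d₂, x₂, h₂⟩ := h₂
    refine ⟨d₁ * d₂, (d₂ : R) • x₁ + (d₁ : R) • x₂, ?_⟩
    rw [map_add, map_smul, map_smul, h₁, h₂, ← algebraMap_smul K (d₂ : R),
      ← algebraMap_smul K (d₁ : R), Submonoid.coe_mul, map_mul]
    module

/-- The value of a pencil of base-changed quadratic forms at a pure tensor `1 ⊗ v`. -/
theorem QuadraticForm.baseChange_pencil_one_tmul {k V A : Type*} [CommRing k]
    [Invertible (2 : k)] [AddCommGroup V] [Module k V] [CommRing A] [Algebra k A]
    (q₁ q₂ : QuadraticForm k V) (a : A) (v : V) :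
    (q₁.baseChange A + a • q₂.baseChange A) (1 ⊗ₜ v) =
      algebraMap k A (q₁ v) + a * algebraMap k A (q₂ v) := by
  simp [Algebra.algebraMap_eq_smul_one]

/-- **The Amer–Brumer theorem** (Theorem 2.28 of "Fibrations in complete intersections
of quadrics", at the generic point): two quadratic forms `q₁, q₂` over a field `k` of
characteristic `≠ 2` have a common nontrivial zero if and only if the pencil form
`q₁ + t q₂` is isotropic over the rational function field `k(t)`. -/
theorem amer_brumer
    {k : Type*} [Field k] (h2 : (2 : k) ≠ 0)
    {V : Type*} [AddCommGroup V] [Module k V] [FiniteDimensional k V]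
    (q₁ q₂ : QuadraticForm k V) :
    letI : Invertible (2 : k) := invertibleOfNonzero h2
    ((∃ v : V, v ≠ 0 ∧ q₁ v = 0 ∧ q₂ v = 0) ↔
      ∃ x : RatFunc k ⊗[k] V, x ≠ 0 ∧
        (q₁.baseChange (RatFunc k) + (RatFunc.X : RatFunc k) • q₂.baseChange (RatFunc k)) x
          = 0) := by
  let : Invertible (2 : k) := invertibleOfNonzero h2
  constructor
  · rintro ⟨v, hv, h₁, h₂⟩
    refine ⟨1 ⊗ₜ v, fun h => hv ?_, ?_⟩
    · exact (Module.FaithfullyFlat.one_tmul_eq_zero_iff k V (A := RatFunc k) v).1 h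
    · rw [QuadraticForm.baseChange_pencil_one_tmul, h₁, h₂]
      simp
  · rintro ⟨y, hy, hQy⟩
    obtain ⟨d, x, hx⟩ :=
      IsLocalization.exists_smul_eq_map_algebraMap (nonZeroDivisors (Polynomial k)) y
    have hd : algebraMap (Polynomial k) (RatFunc k) d ≠ 0 :=
      IsLocalization.to_map_ne_zero_of_mem_nonZeroDivisors _ le_rfl d.2
    set P := q₁.baseChange (Polynomial k) +
      (Polynomial.X : Polynomial k) • q₂.baseChange (Polynomial k) with hP
    have hx0 : x ≠ 0 := by
      rintro rfl
      rw [map_zero, eq_comm, smul_eq_zero, or_iff_right hd] at hx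
      exact hy hx
    have hPx : P x = 0 := by
      apply FaithfulSMul.algebraMap_injective (Polynomial k) (RatFunc k)
      have : algebraMap (Polynomial k) (RatFunc k) (P x) =
          (q₁.baseChange (RatFunc k) + (RatFunc.X : RatFunc k) • q₂.baseChange (RatFunc k))
            (algebraMap (Polynomial k) (RatFunc k) d • y) := by
        rw [← hx]
        simp [hP, QuadraticForm.baseChange_map_algebraMap]
      rw [this, QuadraticMap.map_smul, hQy, smul_zero, map_zero]
    let b := Module.finBasis k V
    let e := (b.baseChange (Polynomial k)).equivFun
    let Q : QuadraticForm (Polynomial k) (Fin (Module.finrank k V) → Polynomial k) :=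
      P.comp e.symm.toLinearMap
    have hconst (c : Fin (Module.finrank k V) → k) :
        (Q fun i => Polynomial.C (c i)) = Polynomial.C (q₁ (b.equivFun.symm c)) +
          Polynomial.X * Polynomial.C (q₂ (b.equivFun.symm c)) := by
      have : e.symm (fun i => Polynomial.C (c i)) = 1 ⊗ₜ b.equivFun.symm c := by
        simp [e, Module.Basis.equivFun_symm_apply, tmul_sum, smul_tmul',
          Polynomial.smul_eq_C_mul]
      change P (e.symm _) = _
      rw [this, hP, QuadraticForm.baseChange_pencil_one_tmul]
      rfl
    obtain ⟨c, hc, hQc⟩ := Q.exists_const_isotropic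
      (fun c => by rw [hconst]; compute_degree)
      (Finset.univ.sup fun i => (e x i).natDegree) (e x) (by simpa using hx0)
      (fun i => Finset.le_sup (f := fun i => (e x i).natDegree) (Finset.mem_univ i))
      (by simpa [Q] using hPx)
    rw [hconst] at hQc
    refine ⟨b.equivFun.symm c, b.equivFun.symm.map_ne_zero_iff.2 hc, ?_, ?_⟩
    · simpa using congrArg (Polynomial.coeff · 0) hQc
    · simpa [Polynomial.coeff_C] using congrArg (Polynomial.coeff · 1) hQc
end

section
/- Let k be a field of characteristic different from 2, V a finite-dimensional k-vector space, q₁, q₂ : V → k two quadratic forms, and d a natural number. Then there exists a k-subspace W ≤ V with dim W = d on which both q₁ and q₂ vanish identically if and only if there exists a k(t)-subspace W' ≤ k(t) ⊗[k] V with dim W' = d on which the quadratic form (q₁).baseChange(k(t)) + X • (q₂).baseChange(k(t)) vanishes identically. -/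
open TensorProduct

open Polynomial in
/-- The polynomials of degree less than `n`, viewed inside the field of rational functions. -/
noncomputable def ratFuncDegreeLT (k : Type*) [Field k] (n : ℕ) : Submodule k (RatFunc k) :=
  (degreeLT k n).map (IsScalarTower.toAlgHom k k[X] (RatFunc k)).toLinearMap

/-- The elements of `k(t) ⊗ V` that are polynomials in `t` of degree less than `n` with
coefficients in `V`. -/
noncomputable def tensorDegreeLT (k : Type*) [Field k] (V : Type*) [AddCommGroup V] [Module k V]
    (n : ℕ) : Submodule k (RatFunc k ⊗[k] V) :=
  Submodule.span k {x | ∃ a ∈ ratFuncDegreeLT k n, ∃ v : V, a ⊗ₜ[k] v = x}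

/-- The pencil form `q₁ + t q₂` over `k(t)`. -/
noncomputable abbrev pencilForm {k : Type*} [Field k] [Invertible (2 : k)]
    {V : Type*} [AddCommGroup V] [Module k V] (q₁ q₂ : QuadraticForm k V) :
    QuadraticForm (RatFunc k) (RatFunc k ⊗[k] V) :=
  q₁.baseChange (RatFunc k) + (RatFunc.X : RatFunc k) • q₂.baseChange (RatFunc k)

section PolynomialVectors

variable {k : Type*} [Field k] {V : Type*} [AddCommGroup V] [Module k V]

open Polynomial in
lemma mem_ratFuncDegreeLT {n : ℕ} {a : RatFunc k} :
    a ∈ ratFuncDegreeLT k n ↔ ∃ p : k[X], p.degree < n ∧ algebraMap k[X] (RatFunc k) p = a := by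
  simp [ratFuncDegreeLT, mem_degreeLT]

lemma ratFuncDegreeLT_mono {m n : ℕ} (h : m ≤ n) : ratFuncDegreeLT k m ≤ ratFuncDegreeLT k n :=
  Submodule.map_mono (Polynomial.degreeLT_mono h)

lemma algebraMap_mem_ratFuncDegreeLT (a : k) (n : ℕ) :
    algebraMap k (RatFunc k) a ∈ ratFuncDegreeLT k (n + 1) := by
  refine mem_ratFuncDegreeLT.2 ⟨Polynomial.C a, ?_, ?_⟩
  · exact Polynomial.degree_C_le.trans_lt (by exact_mod_cast Nat.succ_pos n)
  · rw [Polynomial.C_eq_algebraMap, ← IsScalarTower.algebraMap_apply]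

lemma mem_ratFuncDegreeLT_of_X_mul_mem {m n : ℕ} {a : RatFunc k} (ha : a ∈ ratFuncDegreeLT k m)
    (h : RatFunc.X * a ∈ ratFuncDegreeLT k (n + 1)) : a ∈ ratFuncDegreeLT k n := by
  obtain ⟨p, -, rfl⟩ := mem_ratFuncDegreeLT.1 ha
  obtain ⟨r, hr, hrp⟩ := mem_ratFuncDegreeLT.1 h
  refine mem_ratFuncDegreeLT.2 ⟨p, ?_, rfl⟩
  rw [← RatFunc.algebraMap_X, ← map_mul] at hrp
  obtain rfl := RatFunc.algebraMap_injective k hrp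
  rcases eq_or_ne p 0 with rfl | hp
  · simp
  · rw [Polynomial.degree_eq_natDegree (mul_ne_zero Polynomial.X_ne_zero hp),
      Polynomial.natDegree_X_mul hp] at hr
    rw [Polynomial.degree_eq_natDegree hp]
    norm_cast at hr ⊢
    omega

lemma mul_pencil_mem_ratFuncDegreeLT {m n : ℕ} {a b : RatFunc k} (ha : a ∈ ratFuncDegreeLT k m)
    (hb : b ∈ ratFuncDegreeLT k n) (c d : k) :
    a * b * (algebraMap k (RatFunc k) c + RatFunc.X * algebraMap k (RatFunc k) d) ∈
      ratFuncDegreeLT k (m + n) := by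
  obtain ⟨p, hp, rfl⟩ := mem_ratFuncDegreeLT.1 ha
  obtain ⟨r, hr, rfl⟩ := mem_ratFuncDegreeLT.1 hb
  refine mem_ratFuncDegreeLT.2
    ⟨p * r * (Polynomial.C c + Polynomial.X * Polynomial.C d), ?_, ?_⟩
  · rcases eq_or_ne p 0 with rfl | hp0
    · simp
    rcases eq_or_ne r 0 with rfl | hr0
    · simp
    rw [Polynomial.degree_eq_natDegree hp0] at hp
    rw [Polynomial.degree_eq_natDegree hr0] at hr
    have hl : (Polynomial.C c + Polynomial.X * Polynomial.C d).natDegree ≤ 1 := by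
      compute_degree
    have h1 := Polynomial.natDegree_mul_le (p := p * r)
      (q := Polynomial.C c + Polynomial.X * Polynomial.C d)
    have h2 := Polynomial.natDegree_mul_le (p := p) (q := r)
    refine Polynomial.degree_le_natDegree.trans_lt ?_
    norm_cast at hp hr ⊢
    omega
  · simp only [map_mul, map_add, RatFunc.algebraMap_X, Polynomial.C_eq_algebraMap,
      ← IsScalarTower.algebraMap_apply]

lemma tmul_mem_tensorDegreeLT {n : ℕ} {a : RatFunc k} (ha : a ∈ ratFuncDegreeLT k n) (v : V) :
    a ⊗ₜ[k] v ∈ tensorDegreeLT k V n :=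
  Submodule.subset_span ⟨a, ha, v, rfl⟩

lemma one_tmul_mem_tensorDegreeLT (v : V) : (1 : RatFunc k) ⊗ₜ[k] v ∈ tensorDegreeLT k V 1 :=
  tmul_mem_tensorDegreeLT (by simpa using algebraMap_mem_ratFuncDegreeLT (1 : k) 0) v

lemma tensorDegreeLT_mono {m n : ℕ} (h : m ≤ n) : tensorDegreeLT k V m ≤ tensorDegreeLT k V n :=
  Submodule.span_mono fun _ ⟨a, ha, v, hx⟩ ↦ ⟨a, ratFuncDegreeLT_mono h ha, v, hx⟩

lemma eq_zero_of_mem_tensorDegreeLT_zero {x : RatFunc k ⊗[k] V}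
    (hx : x ∈ tensorDegreeLT k V 0) : x = 0 := by
  refine (Submodule.mem_bot k).1 (Submodule.span_le.2 ?_ hx)
  rintro _ ⟨a, ha, v, rfl⟩
  obtain ⟨p, hp, rfl⟩ := mem_ratFuncDegreeLT.1 ha
  have : p = 0 := by simpa using hp
  simp [this]

lemma exists_eq_tmul_add_X_smul {n : ℕ} {x : RatFunc k ⊗[k] V}
    (hx : x ∈ tensorDegreeLT k V (n + 1)) :
    ∃ v : V, ∃ y ∈ tensorDegreeLT k V n,
      x = (1 : RatFunc k) ⊗ₜ[k] v + (RatFunc.X : RatFunc k) • y := by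
  induction hx using Submodule.span_induction with
  | mem x h =>
    obtain ⟨a, ha, v, rfl⟩ := h
    obtain ⟨p, hp, rfl⟩ := mem_ratFuncDegreeLT.1 ha
    refine ⟨p.coeff 0 • v, algebraMap _ (RatFunc k) p.divX ⊗ₜ v,
      tmul_mem_tensorDegreeLT (mem_ratFuncDegreeLT.2 ⟨_, ?_, rfl⟩) v, ?_⟩
    · rcases eq_or_ne p.divX 0 with h0 | h0
      · simp [h0]
      · have hp0 : p ≠ 0 := by rintro rfl; simp at h0
        have hlt := Polynomial.degree_divX_lt hp0
        rw [Polynomial.degree_eq_natDegree hp0] at hp hlt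
        rw [Polynomial.degree_eq_natDegree h0] at hlt ⊢
        norm_cast at hp hlt ⊢
        omega
    · conv_lhs => rw [← Polynomial.divX_mul_X_add p]
      rw [map_add, map_mul, RatFunc.algebraMap_X, TensorProduct.add_tmul, add_comm,
        TensorProduct.tmul_smul, TensorProduct.smul_tmul', TensorProduct.smul_tmul', smul_eq_mul,
        mul_comm, Polynomial.C_eq_algebraMap, ← IsScalarTower.algebraMap_apply,
        Algebra.algebraMap_eq_smul_one]
  | zero => exact ⟨0, 0, zero_mem _, by simp⟩
  | add x y _ _ hx hy =>
    obtain ⟨v, x', hx', rfl⟩ := hx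
    obtain ⟨w, y', hy', rfl⟩ := hy
    exact ⟨v + w, x' + y', add_mem hx' hy', by rw [TensorProduct.tmul_add, smul_add]; abel⟩
  | smul c x _ hx =>
    obtain ⟨v, x', hx', rfl⟩ := hx
    exact ⟨c • v, c • x', Submodule.smul_mem _ c hx', by
      rw [TensorProduct.tmul_smul, smul_add, smul_comm c]⟩

open Polynomial in
lemma algebraMap_smul_mem_tensorDegreeLT {n : ℕ} {x : RatFunc k ⊗[k] V}
    (hx : x ∈ tensorDegreeLT k V n) (p : k[X]) :
    algebraMap k[X] (RatFunc k) p • x ∈ tensorDegreeLT k V (n + p.natDegree) := by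
  induction hx using Submodule.span_induction with
  | mem x h =>
    obtain ⟨a, ha, v, rfl⟩ := h
    obtain ⟨r, hr, rfl⟩ := mem_ratFuncDegreeLT.1 ha
    rw [TensorProduct.smul_tmul', smul_eq_mul, ← map_mul]
    refine tmul_mem_tensorDegreeLT (mem_ratFuncDegreeLT.2 ⟨_, ?_, rfl⟩) v
    rcases eq_or_ne r 0 with rfl | hr0
    · simp
    · have h := Polynomial.natDegree_mul_le (p := p) (q := r)
      rw [Polynomial.degree_eq_natDegree hr0] at hr
      refine Polynomial.degree_le_natDegree.trans_lt ?_
      norm_cast at hr ⊢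
      omega
  | zero => simp
  | add x y _ _ hx hy => rw [smul_add]; exact add_mem hx hy
  | smul c x _ hx => rw [smul_comm]; exact Submodule.smul_mem _ c hx

open Polynomial in
lemma exists_algebraMap_smul_mem_tensorDegreeLT (x : RatFunc k ⊗[k] V) :
    ∃ p : k[X], p ≠ 0 ∧ ∃ n, algebraMap k[X] (RatFunc k) p • x ∈ tensorDegreeLT k V n := by
  induction x with
  | zero => exact ⟨1, one_ne_zero, 0, by simp⟩
  | tmul a v =>
    refine ⟨a.denom, a.denom_ne_zero, a.num.natDegree + 1, ?_⟩
    rw [TensorProduct.smul_tmul']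
    refine tmul_mem_tensorDegreeLT (mem_ratFuncDegreeLT.2 ⟨a.num, ?_, ?_⟩) v
    · exact Polynomial.degree_le_natDegree.trans_lt (by exact_mod_cast Nat.lt_succ_self _)
    · have h0 : algebraMap k[X] (RatFunc k) a.denom ≠ 0 := by simp [a.denom_ne_zero]
      rw [smul_eq_mul, mul_comm, ← div_eq_iff h0, RatFunc.num_div_denom]
  | add x y hx hy =>
    obtain ⟨p, hp, m, hm⟩ := hx
    obtain ⟨r, hr, n, hn⟩ := hy
    refine ⟨p * r, mul_ne_zero hp hr, (m + r.natDegree) + (n + p.natDegree), ?_⟩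
    rw [smul_add]
    refine add_mem (tensorDegreeLT_mono (Nat.le_add_right _ _) ?_)
      (tensorDegreeLT_mono (Nat.le_add_left _ _) ?_)
    · rw [mul_comm, map_mul, mul_smul]
      exact algebraMap_smul_mem_tensorDegreeLT hm r
    · rw [map_mul, mul_smul]
      exact algebraMap_smul_mem_tensorDegreeLT hn p

lemma smul_one_tmul_mem_tensorDegreeLT {n : ℕ} {a : RatFunc k} (ha : a ∈ ratFuncDegreeLT k n)
    (c : k) (v : V) :
    (a / algebraMap k (RatFunc k) c) • ((1 : RatFunc k) ⊗ₜ[k] v) ∈ tensorDegreeLT k V n := by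
  have h : a / algebraMap k (RatFunc k) c = c⁻¹ • a := by
    rw [Algebra.smul_def, map_inv₀, div_eq_inv_mul]
  rw [h, TensorProduct.smul_tmul', smul_eq_mul, mul_one]
  exact tmul_mem_tensorDegreeLT (Submodule.smul_mem _ _ ha) v

lemma update_mem_update {ι : Type*} [DecidableEq ι] {d : ι → ℕ} {x : ι → RatFunc k ⊗[k] V}
    (hx : ∀ i, x i ∈ tensorDegreeLT k V (d i)) {i : ι} {m : ℕ} {z : RatFunc k ⊗[k] V}
    (hz : z ∈ tensorDegreeLT k V m) (j : ι) :
    Function.update x i z j ∈ tensorDegreeLT k V (Function.update d i m j) := by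
  rcases eq_or_ne j i with rfl | h
  · simpa using hz
  · simpa [h] using hx j

end PolynomialVectors

section PencilForm

open QuadraticMap

variable {k : Type*} [Field k] [Invertible (2 : k)] {V : Type*} [AddCommGroup V] [Module k V]
  (q₁ q₂ : QuadraticForm k V)

lemma QuadraticForm.polar_baseChange_tmul {A : Type*} [CommRing A] [Algebra k A]
    (q : QuadraticForm k V) (a b : A) (v w : V) :
    polar (q.baseChange A) (a ⊗ₜ[k] v) (b ⊗ₜ[k] w) = a * b * algebraMap k A (polar q v w) := by
  let : Invertible (2 : A) := (Invertible.map (algebraMap k A) 2).copy 2 (map_ofNat _ _).symm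
  have h := LinearMap.congr_fun₂ (QuadraticForm.polarBilin_baseChange (A := A) q)
    (a ⊗ₜ[k] v) (b ⊗ₜ[k] w)
  rw [LinearMap.BilinForm.baseChange_tmul] at h
  rw [← polarBilin_apply_apply, h, polarBilin_apply_apply, Algebra.smul_def, mul_comm]

lemma pencilForm_one_tmul (v : V) :
    pencilForm q₁ q₂ (1 ⊗ₜ v) =
      algebraMap k (RatFunc k) (q₁ v) + RatFunc.X * algebraMap k (RatFunc k) (q₂ v) := by
  simp only [add_apply, smul_apply, QuadraticForm.baseChange_tmul,
    mul_one, Algebra.algebraMap_eq_smul_one, smul_eq_mul]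

lemma polar_pencilForm_tmul (a b : RatFunc k) (v w : V) :
    polar (pencilForm q₁ q₂) (a ⊗ₜ v) (b ⊗ₜ w) =
      a * b * (algebraMap k (RatFunc k) (polar q₁ v w) +
        RatFunc.X * algebraMap k (RatFunc k) (polar q₂ v w)) := by
  rw [pencilForm, FunLike.coe_add, polar_add, FunLike.coe_smul, polar_smul,
    QuadraticForm.polar_baseChange_tmul, QuadraticForm.polar_baseChange_tmul, smul_eq_mul]
  ring

lemma polar_pencilForm_mem {m n : ℕ} {x y : RatFunc k ⊗[k] V} (hx : x ∈ tensorDegreeLT k V m)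
    (hy : y ∈ tensorDegreeLT k V n) :
    polar (pencilForm q₁ q₂) x y ∈ ratFuncDegreeLT k (m + n) := by
  induction hx, hy using Submodule.span_induction₂ with
  | mem_mem x y hx hy =>
    obtain ⟨a, ha, v, rfl⟩ := hx
    obtain ⟨b, hb, w, rfl⟩ := hy
    rw [polar_pencilForm_tmul]
    exact mul_pencil_mem_ratFuncDegreeLT ha hb _ _
  | zero_left => rw [polar_zero_left]; exact zero_mem _
  | zero_right => rw [polar_zero_right]; exact zero_mem _
  | add_left x y z _ _ _ hx hy => rw [polar_add_left]; exact add_mem hx hy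
  | add_right x y z _ _ _ hx hy => rw [polar_add_right]; exact add_mem hx hy
  | smul_left c x y _ _ h => rw [polar_smul_left_of_tower]; exact Submodule.smul_mem _ c h
  | smul_right c x y _ _ h => rw [polar_smul_right_of_tower]; exact Submodule.smul_mem _ c h

lemma pencilForm_mem {n : ℕ} {x : RatFunc k ⊗[k] V} (hx : x ∈ tensorDegreeLT k V n) :
    pencilForm q₁ q₂ x ∈ ratFuncDegreeLT k (n + n) := by
  have h := Submodule.smul_mem _ (⅟(2 : k)) (polar_pencilForm_mem q₁ q₂ hx hx)
  rwa [polar_self, ← Nat.cast_smul_eq_nsmul k, smul_smul, Nat.cast_ofNat, invOf_mul_self,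
    one_smul] at h

variable {q₁ q₂}

lemma eq_zero_of_pencilForm_eq_zero {n : ℕ} {v : V} {y : RatFunc k ⊗[k] V}
    (hy : y ∈ tensorDegreeLT k V n)
    (h : pencilForm q₁ q₂ ((1 : RatFunc k) ⊗ₜ[k] v + (RatFunc.X : RatFunc k) • y) = 0) :
    q₁ v = 0 ∧ algebraMap k (RatFunc k) (q₂ v) + polar (pencilForm q₁ q₂) (1 ⊗ₜ v) y
      + RatFunc.X * pencilForm q₁ q₂ y = 0 := by
  have h' : algebraMap k (RatFunc k) (q₁ v) + RatFunc.X * (algebraMap k (RatFunc k) (q₂ v) +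
      polar (pencilForm q₁ q₂) (1 ⊗ₜ v) y + RatFunc.X * pencilForm q₁ q₂ y) = 0 := by
    rw [QuadraticMap.map_add (pencilForm q₁ q₂), pencilForm_one_tmul, QuadraticMap.map_smul, polar_smul_right,
      smul_eq_mul, smul_eq_mul] at h
    linear_combination h
  have hq₁ : q₁ v = 0 := by
    obtain ⟨p, -, hp⟩ := mem_ratFuncDegreeLT.1
      (polar_pencilForm_mem q₁ q₂ (one_tmul_mem_tensorDegreeLT v) hy)
    obtain ⟨r, -, hr⟩ := mem_ratFuncDegreeLT.1 (pencilForm_mem q₁ q₂ hy)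
    have hpoly : Polynomial.C (q₁ v) + Polynomial.X *
        (Polynomial.C (q₂ v) + p + Polynomial.X * r) = 0 := by
      apply RatFunc.algebraMap_injective k
      rw [← hp, ← hr] at h'
      simpa only [map_add, map_mul, map_zero, RatFunc.algebraMap_X, Polynomial.C_eq_algebraMap,
        ← IsScalarTower.algebraMap_apply] using h'
    simpa using congrArg (Polynomial.eval 0) hpoly
  refine ⟨hq₁, ?_⟩
  rw [hq₁, map_zero, zero_add] at h'
  exact (mul_eq_zero.1 h').resolve_left RatFunc.X_ne_zero

end PencilForm

namespace QuadraticMap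

variable {K M : Type*} [Field K] [AddCommGroup M] [Module K M] (Q : QuadraticForm K M)

/-- The reflection in the hyperplane orthogonal to an anisotropic vector. -/
noncomputable def hyperplaneReflection {u : M} (hu : Q u ≠ 0) : M ≃ₗ[K] M :=
  Module.reflection (x := u) (f := (Q u)⁻¹ • Q.polarBilin.flip u) (by
    simp only [LinearMap.smul_apply, LinearMap.flip_apply, polarBilin_apply_apply, polar_self,
      smul_eq_mul, nsmul_eq_mul]
    field_simp
    norm_num)

lemma hyperplaneReflection_apply {u : M} (hu : Q u ≠ 0) (x : M) :
    Q.hyperplaneReflection hu x = x - (polar Q x u / Q u) • u := by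
  simp [hyperplaneReflection, Module.reflection_apply, div_eq_inv_mul]

lemma map_hyperplaneReflection {u : M} (hu : Q u ≠ 0) (x : M) :
    Q (Q.hyperplaneReflection hu x) = Q x := by
  rw [hyperplaneReflection_apply, sub_eq_add_neg, ← neg_smul, QuadraticMap.map_add Q,
    QuadraticMap.map_smul, polar_smul_right, smul_eq_mul, smul_eq_mul]
  field_simp
  ring

end QuadraticMap

lemma LinearIndependent.update_sum {K M ι : Type*} [Field K] [AddCommGroup M] [Module K M]
    [Fintype ι] [DecidableEq ι] {x : ι → M} (hx : LinearIndependent K x) (c : ι → K) {i : ι}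
    (hi : c i ≠ 0) {r : K} (hr : r ≠ 0) {z : M} (hz : r • z = ∑ j, c j • x j) :
    LinearIndependent K (Function.update x i z) :=
  hx.update i z ⟨r, mem_nonZeroDivisors_of_ne_zero hr, Finsupp.equivFunOnFinite.symm c,
    mem_nonZeroDivisors_of_ne_zero hi, by
      simpa [Finsupp.linearCombination_apply, Finsupp.sum_fintype] using hz⟩

section Descent

open QuadraticMap

variable {k : Type*} [Field k] [Invertible (2 : k)] {V : Type*} [AddCommGroup V] [Module k V]
  {q₁ q₂ : QuadraticForm k V}

/-- The pencil form vanishes on some subspace of `k(t) ⊗ V` containing linearly independent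
vectors which are polynomial in `t` of degree less than `n i`. -/
def HasIsotropicFrame (q₁ q₂ : QuadraticForm k V) {d : ℕ} (n : Fin d → ℕ) : Prop :=
  ∃ W' : Submodule (RatFunc k) (RatFunc k ⊗[k] V), (∀ w ∈ W', pencilForm q₁ q₂ w = 0) ∧
    ∃ x : Fin d → RatFunc k ⊗[k] V, LinearIndependent (RatFunc k) x ∧
      ∀ i, x i ∈ W' ∧ x i ∈ tensorDegreeLT k V (n i)

lemma exists_hasIsotropicFrame [FiniteDimensional k V] {d : ℕ}
    {W' : Submodule (RatFunc k) (RatFunc k ⊗[k] V)} (hd : Module.finrank (RatFunc k) W' = d)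
    (hW' : ∀ w ∈ W', pencilForm q₁ q₂ w = 0) :
    ∃ n : Fin d → ℕ, HasIsotropicFrame q₁ q₂ n := by
  let b := Module.finBasisOfFinrankEq (RatFunc k) W' hd
  have hb : LinearIndependent (RatFunc k) fun i ↦ (b i : RatFunc k ⊗[k] V) :=
    b.linearIndependent.map' W'.subtype W'.ker_subtype
  choose p hp n hn using fun i ↦
    exists_algebraMap_smul_mem_tensorDegreeLT (b i : RatFunc k ⊗[k] V)
  have hp' : ∀ i, algebraMap _ (RatFunc k) (p i) ≠ 0 := fun i ↦ by simpa using hp i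
  exact ⟨n, W', hW', _, hb.units_smul fun i ↦ Units.mk0 _ (hp' i),
    fun i ↦ ⟨W'.smul_mem _ (b i).2, hn i⟩⟩

/-- One descent step: if the constant terms of a polynomial frame of a totally isotropic subspace
do not already give a `d`-dimensional common isotropic subspace of `q₁` and `q₂`, then there is a
totally isotropic subspace with a frame of smaller total degree. -/
lemma HasIsotropicFrame.exists_submodule_or_update {d : ℕ} {n : Fin d → ℕ}
    (h : HasIsotropicFrame q₁ q₂ n) :
    (∃ W : Submodule k V, Module.finrank k W = d ∧ ∀ w ∈ W, q₁ w = 0 ∧ q₂ w = 0) ∨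
      ∃ i m, m < n i ∧ HasIsotropicFrame q₁ q₂ (Function.update n i m) := by
  obtain ⟨W', hW', x, hx, hxn⟩ := h
  have hpos : ∀ i, ∃ m, n i = m + 1 := fun i ↦ Nat.exists_eq_succ_of_ne_zero fun h0 ↦
    hx.ne_zero i (eq_zero_of_mem_tensorDegreeLT_zero (h0 ▸ (hxn i).2))
  choose m hm using hpos
  obtain rfl : n = fun i ↦ m i + 1 := funext hm
  choose v y hy hxy using fun i ↦ exists_eq_tmul_add_X_smul (hxn i).2
  have hsum : ∀ c : Fin d → k, ∑ i, algebraMap k (RatFunc k) (c i) • x i =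
      (1 : RatFunc k) ⊗ₜ[k] (∑ i, c i • v i) + (RatFunc.X : RatFunc k) • ∑ i, c i • y i := by
    intro c
    simp_rw [algebraMap_smul, TensorProduct.tmul_sum, TensorProduct.tmul_smul, Finset.smul_sum,
      ← Finset.sum_add_distrib]
    refine Finset.sum_congr rfl fun i _ ↦ ?_
    rw [hxy i, smul_add, smul_comm (c i)]
  have hsumW : ∀ c : Fin d → k, ∑ i, algebraMap k (RatFunc k) (c i) • x i ∈ W' :=
    fun c ↦ W'.sum_mem fun i _ ↦ W'.smul_mem _ (hxn i).1
  have hmax : ∀ c : Fin d → k, c ≠ 0 →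
      ∃ i, c i ≠ 0 ∧ ∑ j, c j • y j ∈ tensorDegreeLT k V (m i) := by
    intro c hc
    obtain ⟨j, hj⟩ := Function.ne_iff.1 hc
    classical
    obtain ⟨i, hi, hmi⟩ := Finset.exists_max_image (Finset.univ.filter fun i ↦ c i ≠ 0) m
      ⟨j, by simpa using hj⟩
    refine ⟨i, by simpa using hi, Submodule.sum_mem _ fun j _ ↦ ?_⟩
    rcases eq_or_ne (c j) 0 with h0 | h0
    · simp [h0]
    · exact Submodule.smul_mem _ _ (tensorDegreeLT_mono (hmi j (by simpa using h0)) (hy j))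
  have hq₁ : ∀ c : Fin d → k, q₁ (∑ i, c i • v i) = 0 := by
    intro c
    rcases eq_or_ne c 0 with rfl | hc
    · simp
    obtain ⟨i, -, hi⟩ := hmax c hc
    exact (eq_zero_of_pencilForm_eq_zero hi (hsum c ▸ hW' _ (hsumW c))).1
  by_cases hv : LinearIndependent k v
  swap
  · right
    obtain ⟨c, hc, j, hj⟩ := Fintype.not_linearIndependent_iff.1 hv
    obtain ⟨i, hi, hyi⟩ := hmax c (Function.ne_iff.2 ⟨j, hj⟩)
    have hX := hsum c
    rw [hc, TensorProduct.tmul_zero, zero_add] at hX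
    refine ⟨i, m i, Nat.lt_succ_self _, W', hW', Function.update x i (∑ j, c j • y j),
      hx.update_sum (fun j ↦ algebraMap k (RatFunc k) (c j)) (by simpa using hi)
        RatFunc.X_ne_zero hX.symm, fun j ↦ ⟨?_, update_mem_update (fun i ↦ (hxn i).2) hyi j⟩⟩
    rcases eq_or_ne j i with rfl | hji
    · have := hsumW c
      rw [hX] at this
      simpa using (W'.smul_mem_iff RatFunc.X_ne_zero).1 this
    · simpa [hji] using (hxn j).1
  by_cases hq₂ : ∀ c : Fin d → k, q₂ (∑ i, c i • v i) = 0
  · left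
    refine ⟨Submodule.span k (Set.range v), by simpa using finrank_span_eq_card hv, ?_⟩
    intro w hw
    obtain ⟨c, rfl⟩ := (Submodule.mem_span_range_iff_exists_fun k).1 hw
    exact ⟨hq₁ c, hq₂ c⟩
  · right
    push Not at hq₂
    obtain ⟨c, hc⟩ := hq₂
    obtain ⟨i, hi, hyi⟩ := hmax c (by rintro rfl; simp at hc)
    set u := ∑ i, c i • v i with hu
    set z := ∑ i, c i • y i
    have hg : algebraMap k (RatFunc k) (q₂ u) ≠ 0 := by simpa using hc
    have hX : (RatFunc.X : RatFunc k) ≠ 0 := RatFunc.X_ne_zero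
    have hQu : pencilForm q₁ q₂ (1 ⊗ₜ u) = RatFunc.X * algebraMap k (RatFunc k) (q₂ u) := by
      rw [pencilForm_one_tmul, hq₁ c, map_zero, zero_add]
    have hQu0 : pencilForm q₁ q₂ (1 ⊗ₜ u) ≠ 0 := hQu ▸ mul_ne_zero hX hg
    have hrel := (eq_zero_of_pencilForm_eq_zero hyi (hsum c ▸ hW' _ (hsumW c))).2
    let τ := (pencilForm q₁ q₂).hyperplaneReflection hQu0
    have hτx : ∀ j, τ (x j) ∈ tensorDegreeLT k V (m j + 1) := by
      intro j
      have hpol : polar q₁ (v j) u = 0 := by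
        have h1 : v j + u = ∑ i, (c + Pi.single j 1 : Fin d → k) i • v i := by
          simp [add_smul, Finset.sum_add_distrib, hu, add_comm, Pi.single_apply]
        have h2 : v j = ∑ i, (Pi.single j 1 : Fin d → k) i • v i := by
          simp [Pi.single_apply]
        rw [polar, h1, hq₁, hu, hq₁ c, h2, hq₁]
        simp
      have hpx : polar (pencilForm q₁ q₂) (x j) (1 ⊗ₜ u) = RatFunc.X *
          (algebraMap k (RatFunc k) (polar q₂ (v j) u) +
            polar (pencilForm q₁ q₂) (y j) (1 ⊗ₜ u)) := by
        rw [hxy j, polar_add_left, polar_smul_left, polar_pencilForm_tmul, hpol, map_zero,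
          smul_eq_mul]
        ring
      have : τ (x j) = x j - ((algebraMap k (RatFunc k) (polar q₂ (v j) u) +
          polar (pencilForm q₁ q₂) (y j) (1 ⊗ₜ u)) / algebraMap k (RatFunc k) (q₂ u)) •
            ((1 : RatFunc k) ⊗ₜ[k] u) := by
        rw [hyperplaneReflection_apply, hpx, hQu, mul_div_mul_left _ _ hX]
      rw [this]
      exact sub_mem (hxn j).2 (smul_one_tmul_mem_tensorDegreeLT
        (add_mem (algebraMap_mem_ratFuncDegreeLT _ _)
          (polar_pencilForm_mem q₁ q₂ (hy j) (one_tmul_mem_tensorDegreeLT u))) _ _)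
    have hQz : pencilForm q₁ q₂ z ∈ ratFuncDegreeLT k (m i) := by
      refine mem_ratFuncDegreeLT_of_X_mul_mem (pencilForm_mem q₁ q₂ hyi) ?_
      rw [eq_neg_of_add_eq_zero_right hrel, add_comm (m i)]
      refine neg_mem (add_mem ?_
        (polar_pencilForm_mem q₁ q₂ (one_tmul_mem_tensorDegreeLT u) hyi))
      rw [add_comm]
      exact algebraMap_mem_ratFuncDegreeLT _ _
    let z' := z + (pencilForm q₁ q₂ z / algebraMap k (RatFunc k) (q₂ u)) •
      ((1 : RatFunc k) ⊗ₜ[k] u)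
    have hz' : z' ∈ tensorDegreeLT k V (m i) :=
      add_mem hyi (smul_one_tmul_mem_tensorDegreeLT hQz _ _)
    have hτz : τ (∑ i, algebraMap k (RatFunc k) (c i) • x i) = (RatFunc.X : RatFunc k) • z' := by
      have hcoef : polar (pencilForm q₁ q₂)
          ((1 : RatFunc k) ⊗ₜ[k] u + (RatFunc.X : RatFunc k) • z) (1 ⊗ₜ u) =
          RatFunc.X * (algebraMap k (RatFunc k) (q₂ u) -
            RatFunc.X * pencilForm q₁ q₂ z) := by
        rw [polar_add_left, polar_smul_left, polar_self, hQu, polar_comm _ z, smul_eq_mul,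
          nsmul_eq_mul]
        push_cast
        linear_combination RatFunc.X * hrel
      rw [hsum c, hyperplaneReflection_apply, hcoef, hQu, mul_div_mul_left _ _ hX, sub_div,
        div_self hg, mul_div_assoc]
      simp only [z', smul_add, sub_smul, one_smul, mul_smul]
      abel
    refine ⟨i, m i, Nat.lt_succ_self _, W'.map τ.toLinearMap, ?_,
      Function.update (fun j ↦ τ (x j)) i z',
      (hx.map' τ.toLinearMap τ.ker).update_sum (fun j ↦ algebraMap k (RatFunc k) (c j))
        (by simpa using hi) hX (hτz ▸ by simp), fun j ↦ ⟨?_, update_mem_update hτx hz' j⟩⟩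
    · rintro _ ⟨w, hw, rfl⟩
      exact (map_hyperplaneReflection _ hQu0 w).trans (hW' w hw)
    · rcases eq_or_ne j i with rfl | hji
      · have := Submodule.mem_map_of_mem (f := τ.toLinearMap) (hsumW c)
        rw [LinearEquiv.coe_coe, hτz] at this
        simpa using ((W'.map τ.toLinearMap).smul_mem_iff hX).1 this
      · simpa [hji] using (hxn j).1

lemma HasIsotropicFrame.exists_submodule {d : ℕ} {n : Fin d → ℕ}
    (h : HasIsotropicFrame q₁ q₂ n) :
    ∃ W : Submodule k V, Module.finrank k W = d ∧ ∀ w ∈ W, q₁ w = 0 ∧ q₂ w = 0 := by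
  induction hN : ∑ i, n i using Nat.strong_induction_on generalizing n with
  | _ N ih =>
    rcases h.exists_submodule_or_update with hW | ⟨i, m, hm, h'⟩
    · exact hW
    · refine ih _ ?_ h' rfl
      rw [← hN]
      refine Finset.sum_lt_sum (fun j _ ↦ ?_) ⟨i, Finset.mem_univ i, by simpa using hm⟩
      rcases eq_or_ne j i with rfl | hji
      · simpa using hm.le
      · simp [hji]

lemma pencilForm_baseChange_subtype {W : Submodule k V} (hW : ∀ w ∈ W, q₁ w = 0 ∧ q₂ w = 0)
    (x : RatFunc k ⊗[k] W) : pencilForm q₁ q₂ (W.subtype.baseChange (RatFunc k) x) = 0 := by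
  have h : (pencilForm q₁ q₂).comp (W.subtype.baseChange (RatFunc k)) = 0 := by
    refine baseChange_ext fun w ↦ ?_
    rw [QuadraticMap.comp_apply, LinearMap.baseChange_tmul, pencilForm_one_tmul]
    simp [hW w w.2]
  exact DFunLike.congr_fun h x

end Descent

/-- **Amer's theorem in Leep's dimension-`d` form** (used in the proof of Lemma 5.4 of
"Fibrations in complete intersections of quadrics"): two quadratic forms `q₁, q₂` over a
field `k` of characteristic `≠ 2` vanish simultaneously on a `d`-dimensional subspace if
and only if the pencil form `q₁ + t q₂` over `k(t)` vanishes on a `d`-dimensional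
`k(t)`-subspace. -/
theorem amer_leep_dimension_d
    {k : Type*} [Field k] (h2 : (2 : k) ≠ 0)
    {V : Type*} [AddCommGroup V] [Module k V] [FiniteDimensional k V]
    (q₁ q₂ : QuadraticForm k V) (d : ℕ) :
    letI : Invertible (2 : k) := invertibleOfNonzero h2
    ((∃ W : Submodule k V, Module.finrank k W = d ∧ ∀ w ∈ W, q₁ w = 0 ∧ q₂ w = 0) ↔
      ∃ W' : Submodule (RatFunc k) (RatFunc k ⊗[k] V),
        Module.finrank (RatFunc k) W' = d ∧
        ∀ w ∈ W',
          (q₁.baseChange (RatFunc k) + (RatFunc.X : RatFunc k) • q₂.baseChange (RatFunc k)) w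
            = 0) := by
  let : Invertible (2 : k) := invertibleOfNonzero h2
  constructor
  · rintro ⟨W, hd, hW⟩
    have hinj : Function.Injective (W.subtype.baseChange (RatFunc k)) :=
      Module.Flat.lTensor_preserves_injective_linearMap W.subtype W.injective_subtype
    refine ⟨LinearMap.range (W.subtype.baseChange (RatFunc k)), ?_, ?_⟩
    · rw [LinearMap.finrank_range_of_inj hinj, Module.finrank_baseChange, hd]
    · rintro _ ⟨x, rfl⟩
      exact pencilForm_baseChange_subtype hW x
  · rintro ⟨W', hd, hW'⟩
    obtain ⟨n, hn⟩ := exists_hasIsotropicFrame hd hW'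
    exact hn.exists_submodule
end

section
/- Let R be a commutative ring and P a finite free R-module. Let H(P) be the hyperbolic quadratic form on P × Hom_R(P, R) given by (p, f) ↦ f(p) (Mathlib's QuadraticForm.dualProd). Write ⋀⁺P for the direct sum over i ∈ ℕ of the exterior powers ⋀^{2i} P, and ⋀⁻P for the direct sum over i ∈ ℕ of the exterior powers ⋀^{2i+1} P. Then there is an isomorphism of R-algebras between the even Clifford algebra C₀(H(P)) and the product Module.End R (⋀⁺P) × Module.End R (⋀⁻P). -/
open DirectSum

/-- A family of submodules containing the scalars in degree `0` and compatible with left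
multiplication by vectors contains the even and odd parts of the Clifford algebra. -/
lemma CliffordAlgebra.evenOdd_le_of_ι_mul_mem {R M : Type*} [CommRing R] [AddCommGroup M]
    [Module R M] {Q : QuadraticForm R M} (S : ZMod 2 → Submodule R (CliffordAlgebra Q))
    (one : 1 ∈ S 0) (ι_mul : ∀ i m, ∀ x ∈ S i, ι Q m * x ∈ S (1 + i)) (i : ZMod 2) :
    evenOdd Q i ≤ S i := by
  rw [evenOdd, iSup_le_iff]
  rintro ⟨n, rfl⟩
  change LinearMap.range (ι Q) ^ n ≤ _
  intro x hx
  induction hx using Submodule.pow_induction_on_left' with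
  | algebraMap r =>
    rw [Algebra.algebraMap_eq_smul_one, Nat.cast_zero]
    exact Submodule.smul_mem _ _ one
  | add x y n _ _ hx hy => exact add_mem hx hy
  | mem_mul m hm n x _ hx =>
    obtain ⟨m, rfl⟩ := hm
    rw [Nat.cast_succ, add_comm]
    exact ι_mul _ m x hx

namespace ExteriorAlgebra

open CliffordAlgebra (contractLeft)

variable {R P : Type*} [CommRing R] [AddCommGroup P] [Module R P]

/-- Left exterior multiplication by a vector. -/
noncomputable def creation : P →ₗ[R] Module.End R (ExteriorAlgebra R P) :=
  LinearMap.mul R (ExteriorAlgebra R P) ∘ₗ ι R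

/-- Left contraction by a linear form. -/
noncomputable def annihilation : Module.Dual R P →ₗ[R] Module.End R (ExteriorAlgebra R P) :=
  contractLeft

@[simp]
lemma creation_apply (p : P) (x : ExteriorAlgebra R P) : creation p x = ι R p * x := rfl

lemma annihilation_apply (f : Module.Dual R P) (x : ExteriorAlgebra R P) :
    annihilation f x = contractLeft f x := rfl

lemma creation_mul_self (p : P) : creation (R := R) p * creation p = 0 := by
  refine LinearMap.ext fun x => ?_
  simp [← mul_assoc]

lemma creation_mul_creation (p q : P) :
    (creation p * creation q : Module.End R (ExteriorAlgebra R P)) = -(creation q * creation p) := by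
  refine LinearMap.ext fun x => ?_
  simp only [Module.End.mul_apply, creation_apply, LinearMap.neg_apply, ← mul_assoc]
  rw [eq_neg_of_add_eq_zero_left (ι_add_mul_swap p q), neg_mul]

lemma annihilation_mul_self (f : Module.Dual R P) : annihilation f * annihilation f = 0 := by
  refine LinearMap.ext fun x => ?_
  exact CliffordAlgebra.contractLeft_contractLeft f x

lemma annihilation_mul_annihilation (f g : Module.Dual R P) :
    annihilation f * annihilation g = -(annihilation g * annihilation f) := by
  refine LinearMap.ext fun x => ?_
  exact CliffordAlgebra.contractLeft_comm f g x

lemma annihilation_mul_creation (f : Module.Dual R P) (p : P) :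
    annihilation f * creation p = f p • 1 - creation p * annihilation f := by
  refine LinearMap.ext fun x => ?_
  exact CliffordAlgebra.contractLeft_ι_mul f p x

lemma annihilation_one (f : Module.Dual R P) : annihilation f 1 = 0 :=
  CliffordAlgebra.contractLeft_one _ f

/-- The action of the Clifford algebra of the hyperbolic form on the exterior algebra. -/
noncomputable def cliffordAction :
    CliffordAlgebra (QuadraticForm.dualProd R P) →ₐ[R] Module.End R (ExteriorAlgebra R P) :=
  CliffordAlgebra.lift _ ⟨annihilation ∘ₗ LinearMap.fst R _ _ + creation ∘ₗ LinearMap.snd R _ _, by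
    rintro ⟨f, p⟩
    simp only [LinearMap.add_apply, LinearMap.comp_apply, LinearMap.fst_apply,
      LinearMap.snd_apply, add_mul, mul_add, annihilation_mul_self, creation_mul_self,
      annihilation_mul_creation, QuadraticForm.dualProd_apply, Algebra.algebraMap_eq_smul_one]
    abel⟩

lemma cliffordAction_ι (v : Module.Dual R P × P) :
    cliffordAction (CliffordAlgebra.ι (QuadraticForm.dualProd R P) v) =
      annihilation v.1 + creation v.2 := by
  simp [cliffordAction]

lemma annihilation_mem_range (f : Module.Dual R P) :
    annihilation f ∈ (cliffordAction (R := R) (P := P)).range :=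
  ⟨CliffordAlgebra.ι _ (f, 0), by simp [cliffordAction_ι]⟩

lemma creation_mem_range (p : P) :
    creation p ∈ (cliffordAction (R := R) (P := P)).range :=
  ⟨CliffordAlgebra.ι _ (0, p), by simp [cliffordAction_ι]⟩

lemma mulLeft_mem_range (x : ExteriorAlgebra R P) :
    LinearMap.mulLeft R x ∈ (cliffordAction (R := R) (P := P)).range := by
  induction x using ExteriorAlgebra.induction with
  | algebraMap r =>
    convert Subalgebra.algebraMap_mem (cliffordAction (R := R) (P := P)).range r using 1
    refine LinearMap.ext fun x => ?_
    simp [Algebra.smul_def]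
  | ι p => exact creation_mem_range p
  | mul x y hx hy =>
    rw [LinearMap.mulLeft_mul]
    exact mul_mem hx hy
  | add x y hx hy =>
    convert add_mem hx hy using 1
    refine LinearMap.ext fun z => ?_
    simp [add_mul]

section Basis

variable {I : Type*} (b : Module.Basis I R P)

/-- The projection that kills the basis monomials divisible by `b i`. -/
noncomputable def emptyProj (i : I) : Module.End R (ExteriorAlgebra R P) :=
  annihilation (b.coord i) * creation (b i)

/-- The product of the projections `emptyProj b i` over a list of indices. -/
noncomputable def emptyProjList (L : List I) : Module.End R (ExteriorAlgebra R P) :=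
  (L.map (emptyProj b)).prod

@[simp]
lemma emptyProjList_nil : emptyProjList b [] = 1 := rfl

@[simp]
lemma emptyProjList_cons (i : I) (L : List I) :
    emptyProjList b (i :: L) = emptyProj b i * emptyProjList b L := by
  simp [emptyProjList]

lemma annihilation_mul_creation_self (i : I) :
    annihilation (b.coord i) * creation (b i) =
      1 - creation (b i) * annihilation (b.coord i) := by
  simp [annihilation_mul_creation]

lemma annihilation_mul_creation_of_ne {i j : I} (h : i ≠ j) :
    annihilation (b.coord i) * creation (b j) =
      -(creation (b j) * annihilation (b.coord i)) := by
  simp [annihilation_mul_creation, Finsupp.single_eq_of_ne h]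

lemma commute_creation_emptyProj {i j : I} (h : i ≠ j) :
    Commute (creation (b i)) (emptyProj b j) := by
  have hij := neg_eq_iff_eq_neg.mpr (creation_mul_creation (R := R) (b i) (b j))
  have hji := neg_eq_iff_eq_neg.mpr (annihilation_mul_creation_of_ne b h.symm)
  rw [commute_iff_eq, emptyProj, ← mul_assoc, ← hji, mul_assoc, ← hij, mul_neg, neg_mul, mul_assoc]

lemma commute_annihilation_emptyProj {i j : I} (h : i ≠ j) :
    Commute (annihilation (b.coord i)) (emptyProj b j) := by
  rw [commute_iff_eq, emptyProj, mul_assoc, ← neg_eq_iff_eq_neg.mpr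
    (annihilation_mul_creation_of_ne b h), mul_neg, ← mul_assoc,
    ← mul_assoc, ← neg_mul, annihilation_mul_annihilation (b.coord i)]

lemma commute_creation_emptyProjList {i : I} {L : List I} (h : i ∉ L) :
    Commute (creation (b i)) (emptyProjList b L) := by
  refine Commute.list_prod_right _ _ fun x hx => ?_
  obtain ⟨j, hj, rfl⟩ := List.mem_map.mp hx
  exact commute_creation_emptyProj b (ne_of_mem_of_not_mem hj h).symm

lemma commute_annihilation_emptyProjList {i : I} {L : List I} (h : i ∉ L) :
    Commute (annihilation (b.coord i)) (emptyProjList b L) := by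
  refine Commute.list_prod_right _ _ fun x hx => ?_
  obtain ⟨j, hj, rfl⟩ := List.mem_map.mp hx
  exact commute_annihilation_emptyProj b (ne_of_mem_of_not_mem hj h).symm

lemma emptyProjList_mul_creation {L : List I} (hL : L.Nodup) {j : I} (hj : j ∈ L) :
    emptyProjList b L * creation (b j) = 0 := by
  induction L with
  | nil => simp at hj
  | cons i L ih =>
    rw [List.nodup_cons] at hL
    rw [emptyProjList_cons, mul_assoc]
    rcases List.mem_cons.mp hj with rfl | hj
    · rw [← (commute_creation_emptyProjList b hL.1).eq, ← mul_assoc, emptyProj,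
        mul_assoc (annihilation _), creation_mul_self, mul_zero, zero_mul]
    · rw [ih hL.2 hj, mul_zero]

lemma emptyProjList_one (L : List I) : emptyProjList b L 1 = 1 := by
  induction L with
  | nil => simp
  | cons i L ih =>
    rw [emptyProjList_cons, Module.End.mul_apply, ih, emptyProj, annihilation_mul_creation_self]
    simp [annihilation_one]

lemma emptyProjList_eq_algebraMap {L : List I} (hL : L.Nodup) (hmem : ∀ i, i ∈ L)
    (x : ExteriorAlgebra R P) :
    ∃ r : R, emptyProjList b L x = algebraMap R _ r := by
  have hι (p : P) : emptyProjList b L * creation p = 0 := by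
    have : LinearMap.mulLeft R (emptyProjList b L) ∘ₗ creation = 0 :=
      b.ext fun j => emptyProjList_mul_creation b hL (hmem j)
    exact LinearMap.congr_fun this p
  induction x using CliffordAlgebra.left_induction with
  | algebraMap r =>
    refine ⟨r, ?_⟩
    rw [Algebra.algebraMap_eq_smul_one, map_smul, emptyProjList_one]
  | add x y hx hy =>
    obtain ⟨r, hr⟩ := hx
    obtain ⟨s, hs⟩ := hy
    exact ⟨r + s, by rw [map_add, map_add, hr, hs]⟩
  | ι_mul x p _ => exact ⟨0, by rw [map_zero]; exact LinearMap.congr_fun (hι p) x⟩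

lemma mul_mem_range_of_emptyProjList {L : List I} (hL : L.Nodup)
    (h : ∀ g, g * emptyProjList b L ∈ (cliffordAction (R := R) (P := P)).range)
    (g : Module.End R (ExteriorAlgebra R P)) :
    g ∈ (cliffordAction (R := R) (P := P)).range := by
  induction L with
  | nil => simpa using h g
  | cons i L ih =>
    rw [List.nodup_cons] at hL
    refine ih hL.2 fun g => ?_
    have key : emptyProjList b L = emptyProjList b (i :: L) +
        creation (b i) * (emptyProjList b (i :: L) * annihilation (b.coord i)) := by
      have hp : emptyProj b i * annihilation (b.coord i) = annihilation (b.coord i) := by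
        rw [emptyProj, annihilation_mul_creation_self, sub_mul, mul_assoc, annihilation_mul_self]
        simp
      rw [emptyProjList_cons, mul_assoc, ← (commute_annihilation_emptyProjList b hL.1).eq,
        ← mul_assoc (emptyProj b i), hp, emptyProj, annihilation_mul_creation_self]
      simp only [sub_mul, one_mul, mul_assoc, sub_add_cancel]
    rw [key, mul_add, ← mul_assoc, ← mul_assoc]
    exact add_mem (h g) (mul_mem (h _) (annihilation_mem_range _))

end Basis

lemma cliffordAction_surjective {I : Type*} [Finite I] (b : Module.Basis I R P) :
    Function.Surjective (cliffordAction (R := R) (P := P)) := by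
  have := Fintype.ofFinite I
  intro g
  have hL := (Finset.univ : Finset I).nodup_toList
  refine mul_mem_range_of_emptyProjList b hL (fun g => ?_) g
  convert mul_mem (mulLeft_mem_range (g 1)) (?_ : emptyProjList b Finset.univ.toList ∈ _) using 1
  · refine LinearMap.ext fun x => ?_
    obtain ⟨r, hr⟩ := emptyProjList_eq_algebraMap b hL (by simp) x
    simp [hr, Algebra.algebraMap_eq_smul_one]
  · refine list_prod_mem fun x hx => ?_
    obtain ⟨j, -, rfl⟩ := List.mem_map.mp hx
    exact mul_mem (annihilation_mem_range _) (creation_mem_range _)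

lemma cliffordAction_bijective {I : Type*} [Finite I] (b : Module.Basis I R P) :
    Function.Bijective (cliffordAction (R := R) (P := P)) := by
  classical
  have hs := cliffordAction_surjective b
  refine ⟨?_, hs⟩
  have := Fintype.ofFinite I
  let : LinearOrder I := linearOrderOfSTO (WellOrderingRel (α := I))
  let : LinearOrder (I ⊕ I) := linearOrderOfSTO (WellOrderingRel (α := I ⊕ I))
  let B : LinearMap.BilinForm R (Module.Dual R P × P) :=
    -(LinearMap.id.compl₁₂ (LinearMap.fst R (Module.Dual R P) P) (LinearMap.snd R _ P))
  have hB : B.toQuadraticMap = 0 - QuadraticForm.dualProd R P := by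
    ext v
    simp [B]
  let e₁ := (b.dualBasis.prod b).ExteriorAlgebra
  let e₂ := b.ExteriorAlgebra.end
  let e : CliffordAlgebra (QuadraticForm.dualProd R P) ≃ₗ[R]
      Module.End R (ExteriorAlgebra R P) :=
    CliffordAlgebra.changeFormEquiv hB ≪≫ₗ e₁.equiv e₂ (Fintype.equivOfCardEq (by
      simp [← pow_add]))
  have : Module.Finite R (CliffordAlgebra (QuadraticForm.dualProd R P)) :=
    Module.Finite.of_basis (e₁.map (CliffordAlgebra.changeFormEquiv hB).symm)
  have hinj := OrzechProperty.injective_of_surjective_endomorphism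
    (e.symm.toLinearMap ∘ₗ cliffordAction.toLinearMap) (e.symm.surjective.comp hs)
  rw [LinearMap.coe_comp] at hinj
  exact hinj.of_comp

/-- The even (`i = 0`) or odd (`i = 1`) half of the exterior algebra. -/
abbrev half (R P : Type*) [CommRing R] [AddCommGroup P] [Module R P] (i : ZMod 2) :
    Submodule R (ExteriorAlgebra R P) :=
  CliffordAlgebra.evenOdd (0 : QuadraticForm R P) i

lemma creation_mem_half (p : P) {i : ZMod 2} {x : ExteriorAlgebra R P} (hx : x ∈ half R P i) :
    creation p x ∈ half R P (1 + i) :=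
  SetLike.mul_mem_graded (CliffordAlgebra.ι_mem_evenOdd_one _ p) hx

lemma annihilation_mem_half (f : Module.Dual R P) {i : ZMod 2} {x : ExteriorAlgebra R P}
    (hx : x ∈ half R P i) : annihilation f x ∈ half R P (1 + i) := by
  refine (CliffordAlgebra.evenOdd_le_of_ι_mul_mem
    (fun i => half R P i ⊓ (half R P (1 + i)).comap (annihilation f))
    ⟨SetLike.one_mem_graded _, by simp [annihilation_one]⟩ (fun i p x hx => ?_) i hx).2
  refine ⟨creation_mem_half p hx.1, ?_⟩
  have h : annihilation f (ι R p * x) = f p • x - ι R p * annihilation f x :=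
    CliffordAlgebra.contractLeft_ι_mul f p x
  have hi : (1 + (1 + i) : ZMod 2) = i := by
    rw [← add_assoc, CharTwo.add_self_eq_zero, zero_add]
  refine Submodule.mem_comap.mpr (h ▸ sub_mem ?_ (creation_mem_half p hx.2))
  exact hi.symm ▸ Submodule.smul_mem _ _ hx.1

lemma cliffordAction_mem_half {i j : ZMod 2} {c : CliffordAlgebra (QuadraticForm.dualProd R P)}
    (hc : c ∈ CliffordAlgebra.evenOdd _ i) {x : ExteriorAlgebra R P} (hx : x ∈ half R P j) :
    cliffordAction c x ∈ half R P (i + j) := by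
  refine CliffordAlgebra.evenOdd_le_of_ι_mul_mem
    (fun i => (half R P (i + j)).comap (cliffordAction.toLinearMap.flip x))
    (by simpa using hx) (fun i v c hc => ?_) i hc
  have h : cliffordAction (CliffordAlgebra.ι (QuadraticForm.dualProd R P) v * c) x =
      annihilation v.1 (cliffordAction c x) + creation v.2 (cliffordAction c x) := by
    rw [map_mul, cliffordAction_ι]
    rfl
  refine Submodule.mem_comap.mpr ?_
  rw [add_assoc]
  exact h ▸ add_mem (annihilation_mem_half _ hc) (creation_mem_half _ hc)

/-- The action of the even Clifford algebra on one half of the exterior algebra. -/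
noncomputable def evenAction (j : ZMod 2) :
    CliffordAlgebra.even (QuadraticForm.dualProd R P) →ₐ[R] Module.End R (half R P j) :=
  AlgHom.ofLinearMap
    { toFun c := (cliffordAction c.1).restrict fun x hx => by
        simpa using cliffordAction_mem_half c.2 hx
      map_add' c d := by ext; simp
      map_smul' r c := by ext; simp }
    (by ext; simp) (fun c d => by ext; simp)

lemma evenAction_prod_bijective [Module.Free R P] [Module.Finite R P] :
    Function.Bijective ((evenAction (R := R) (P := P) 0).prod (evenAction 1)) := by
  have hΦ := cliffordAction_bijective (Module.Free.chooseBasis R P)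
  have hcompl := CliffordAlgebra.evenOdd_isCompl (0 : QuadraticForm R P)
  have hext {f g : Module.End R (ExteriorAlgebra R P)}
      (h₀ : ∀ x ∈ half R P 0, f x = g x) (h₁ : ∀ x ∈ half R P 1, f x = g x) : f = g := by
    refine LinearMap.ext fun x => ?_
    obtain ⟨y, hy, z, hz, rfl⟩ := Submodule.mem_sup.mp (
      hcompl.sup_eq_top ▸ Submodule.mem_top (x := x))
    rw [map_add, map_add, h₀ y hy, h₁ z hz]
  constructor
  · intro c d hcd
    obtain ⟨h₀, h₁⟩ := Prod.ext_iff.mp hcd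
    exact Subtype.ext (hΦ.1 (hext
      (fun x hx => congrArg Subtype.val (LinearMap.congr_fun h₀ ⟨x, hx⟩))
      (fun x hx => congrArg Subtype.val (LinearMap.congr_fun h₁ ⟨x, hx⟩))))
  · rintro ⟨f, g⟩
    let F : Module.End R (ExteriorAlgebra R P) := LinearMap.ofIsCompl hcompl
      ((half R P 0).subtype ∘ₗ f) ((half R P 1).subtype ∘ₗ g)
    obtain ⟨c, hc⟩ := hΦ.2 F
    obtain ⟨c₀, h₀, c₁, h₁, rfl⟩ := Submodule.mem_sup.mp
      ((CliffordAlgebra.evenOdd_isCompl (QuadraticForm.dualProd R P)).sup_eq_top ▸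
        Submodule.mem_top (x := c))
    have hF₀ (x : half R P 0) : F x = f x := LinearMap.ofIsCompl_apply_left hcompl x
    have hF₁ (x : half R P 1) : F x = g x := LinearMap.ofIsCompl_apply_right hcompl x
    -- the odd part of `c` maps each half into its intersection with the other one
    have hodd {j : ZMod 2} (x y : half R P j) (hxy : F x = y) : cliffordAction c₁ x = 0 := by
      have hj : cliffordAction c₁ x ∈ half R P j := by
        have h : cliffordAction c₁ x = y - cliffordAction c₀ x := by
          rw [← hxy, ← hc, map_add, LinearMap.add_apply, add_sub_cancel_left]
        have h' := cliffordAction_mem_half h₀ x.2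
        rw [zero_add] at h'
        exact h ▸ sub_mem y.2 h'
      have hj' := cliffordAction_mem_half h₁ x.2
      have hdisj : Disjoint (half R P j) (half R P (1 + j)) :=
        (DirectSum.Decomposition.isInternal (half R P)).submodule_iSupIndep.pairwiseDisjoint
          (by simp)
      exact (Submodule.disjoint_def.mp hdisj) _ hj hj'
    have hval {j : ZMod 2} (x y : half R P j) (hxy : F x = y) : cliffordAction c₀ x = y := by
      rw [← hxy, ← hc, map_add, LinearMap.add_apply, hodd x y hxy, add_zero]
    refine ⟨⟨c₀, h₀⟩, Prod.ext (LinearMap.ext fun x => Subtype.ext ?_)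
      (LinearMap.ext fun x => Subtype.ext ?_)⟩
    · exact hval x (f x) (hF₀ x)
    · exact hval x (g x) (hF₁ x)

/-- The direct sum of the exterior powers of degrees `k i`, where `k` enumerates the natural
numbers of a given parity, is the corresponding half of the exterior algebra. -/
lemma directSum_equiv_half (k : ℕ → ℕ) (hk : Function.Injective k) (j : ZMod 2)
    (hkj : ∀ n : ℕ, (n : ZMod 2) = j ↔ n ∈ Set.range k) :
    Nonempty ((⨁ i : ℕ, ⋀[R]^(k i) P) ≃ₗ[R] half R P j) := by
  have hind := (DirectSum.Decomposition.isInternal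
    (fun i : ℕ => ⋀[R]^i P)).submodule_iSupIndep.comp hk
  refine ⟨LinearEquiv.ofInjective (DirectSum.coeLinearMap fun i => ⋀[R]^(k i) P)
    hind.dfinsupp_lsum_injective ≪≫ₗ LinearEquiv.ofEq _ _ ?_⟩
  rw [DirectSum.range_coeLinearMap]
  apply le_antisymm
  · exact iSup_le fun i => le_iSup (fun n : {n : ℕ // (n : ZMod 2) = j} =>
      LinearMap.range (CliffordAlgebra.ι (0 : QuadraticForm R P)) ^ (n : ℕ))
      ⟨k i, (hkj _).2 ⟨i, rfl⟩⟩
  · refine iSup_le fun n => ?_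
    obtain ⟨i, hi⟩ := (hkj _).1 n.2
    rw [← hi]
    exact le_iSup (fun i => ⋀[R]^(k i) P) i

end ExteriorAlgebra

/-- **The even Clifford algebra of a hyperbolic form** (Example in §2.4 of "Fibrations in
complete intersections of quadrics", trivial value line bundle): for a finite free module
`P`, the even Clifford algebra of the hyperbolic form on `P × Hom(P, R)` is isomorphic to
the product of the endomorphism algebras of the even and odd halves of the exterior
algebra of `P`. -/
theorem even_clifford_hyperbolic
    {R P : Type*} [CommRing R] [AddCommGroup P] [Module R P]
    [Module.Free R P] [Module.Finite R P] :
    Nonempty ((CliffordAlgebra.even (QuadraticForm.dualProd R P)) ≃ₐ[R]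
      (Module.End R (⨁ i : ℕ, ↥(⋀[R]^(2 * i) P)) ×
        Module.End R (⨁ i : ℕ, ↥(⋀[R]^(2 * i + 1) P)))) := by
  obtain ⟨e₀⟩ := ExteriorAlgebra.directSum_equiv_half (R := R) (P := P) (fun i => 2 * i)
    (fun i j h => by simpa using h) 0 fun n => by
      rw [ZMod.natCast_eq_zero_iff_even, even_iff_two_dvd]
      exact ⟨fun ⟨i, hi⟩ => ⟨i, hi.symm⟩, fun ⟨i, hi⟩ => ⟨i, hi.symm⟩⟩
  obtain ⟨e₁⟩ := ExteriorAlgebra.directSum_equiv_half (R := R) (P := P) (fun i => 2 * i + 1)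
    (fun i j h => by simpa using h) 1 fun n => by
      rw [ZMod.natCast_eq_one_iff_odd]
      exact ⟨fun ⟨i, hi⟩ => ⟨i, hi.symm⟩, fun ⟨i, hi⟩ => ⟨i, hi.symm⟩⟩
  exact ⟨(AlgEquiv.ofBijective _ ExteriorAlgebra.evenAction_prod_bijective).trans
    (AlgEquiv.prodCongr (LinearEquiv.conjAlgEquiv R e₀.symm) (LinearEquiv.conjAlgEquiv R e₁.symm))⟩
end

section
/- Let R be a commutative ring, M an R-module, q : M → R a quadratic form, and A a commutative R-algebra in which 2 is invertible. Then there is an isomorphism of A-algebras between the even Clifford algebra of the base-changed quadratic form q.baseChange A on A ⊗[R] M and the base change A ⊗[R] C₀(q) of the even Clifford algebra of q. -/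
open TensorProduct

namespace CliffordAlgebra

section

variable {R M : Type*} (A : Type*) [CommRing R] [AddCommGroup M] [Module R M]
  [CommRing A] [Algebra R A] [Invertible (2 : R)] (q : QuadraticForm R M)

/-- The map `A ⊗[R] C₀(q) → C(q.baseChange A)` induced by the inclusion of the even part. -/
noncomputable def ofBaseChangeEven :
    A ⊗[R] (even q) →ₐ[A] CliffordAlgebra (q.baseChange A) :=
  (ofBaseChange A q).comp (Algebra.TensorProduct.map (AlgHom.id A A) (even q).val)

theorem ofBaseChangeEven_tmul (a : A) (x : even q) :
    ofBaseChangeEven A q (a ⊗ₜ x) = ofBaseChange A q (a ⊗ₜ (x : CliffordAlgebra q)) :=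
  rfl

theorem ofBaseChangeEven_tmul_ι (a b : A) (m n : M) :
    ofBaseChangeEven A q ((a * b) ⊗ₜ (even.ι q).bilin m n) =
      ι (q.baseChange A) (a ⊗ₜ m) * ι (q.baseChange A) (b ⊗ₜ n) := by
  rw [ofBaseChangeEven_tmul, ← ofBaseChange_tmul_ι, ← ofBaseChange_tmul_ι, ← map_mul,
    Algebra.TensorProduct.tmul_mul_tmul]
  rfl

theorem ofBaseChangeEven_injective : Function.Injective (ofBaseChangeEven A q) := by
  have hof : Function.Injective (ofBaseChange A q) :=
    Function.LeftInverse.injective (toBaseChange_ofBaseChange A q)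
  obtain ⟨p, hp⟩ : ∃ p : CliffordAlgebra q →ₗ[R] evenOdd q 0,
      p ∘ₗ (evenOdd q 0).subtype = LinearMap.id :=
    ⟨Submodule.projectionOnto _ _ (evenOdd_isCompl q),
      LinearMap.ext fun x => Submodule.projectionOnto_apply_left (evenOdd_isCompl q) x⟩
  have hincl : Function.Injective ((evenOdd q 0).subtype.lTensor A) := by
    refine Function.LeftInverse.injective (g := p.lTensor A) fun x => ?_
    rw [← LinearMap.comp_apply, ← LinearMap.lTensor_comp, hp, LinearMap.lTensor_id,
      LinearMap.id_apply]
  exact hof.comp hincl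

theorem ι_mul_ι_mem_range_ofBaseChangeEven (v w : A ⊗[R] M) :
    ι (q.baseChange A) v * ι (q.baseChange A) w ∈ (ofBaseChangeEven A q).range := by
  induction v with
  | zero => simp
  | add v₁ v₂ h₁ h₂ => rw [map_add, add_mul]; exact add_mem h₁ h₂
  | tmul a m =>
    induction w with
    | zero => simp
    | add w₁ w₂ h₁ h₂ => rw [map_add, mul_add]; exact add_mem h₁ h₂
    | tmul b n => exact ⟨_, ofBaseChangeEven_tmul_ι A q a b m n⟩

theorem ofBaseChange_tmul_mem_even (a : A) (x : CliffordAlgebra q) (hx : x ∈ evenOdd q 0) :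
    ofBaseChange A q (a ⊗ₜ x) ∈ even (q.baseChange A) := by
  induction x, hx using even_induction generalizing a with
  | algebraMap r =>
    rw [Algebra.algebraMap_eq_smul_one, ← TensorProduct.smul_tmul, ofBaseChange_tmul_one]
    exact Subalgebra.algebraMap_mem _ _
  | add x y hx hy ihx ihy =>
    rw [TensorProduct.tmul_add, map_add]
    exact add_mem (ihx a) (ihy a)
  | ι_mul_ι_mul m n x hx ih =>
    have h : a ⊗ₜ[R] (ι q m * ι q n * x) = (1 ⊗ₜ ι q m) * (1 ⊗ₜ ι q n) * (a ⊗ₜ x) := by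
      simp [Algebra.TensorProduct.tmul_mul_tmul]
    rw [h, map_mul, map_mul, ofBaseChange_tmul_ι, ofBaseChange_tmul_ι]
    exact mul_mem (ι_mul_ι_mem_evenOdd_zero _ _ _) (ih a)

theorem range_ofBaseChangeEven : (ofBaseChangeEven A q).range = even (q.baseChange A) := by
  apply le_antisymm
  · rintro _ ⟨x, rfl⟩
    change ofBaseChangeEven A q x ∈ _
    induction x with
    | zero => rw [map_zero]; exact zero_mem _
    | add x y hx hy => rw [map_add]; exact add_mem hx hy
    | tmul a x => exact ofBaseChange_tmul_mem_even A q a x x.2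
  · intro x hx
    change x ∈ evenOdd (q.baseChange A) 0 at hx
    induction x, hx using even_induction with
    | algebraMap r => exact Subalgebra.algebraMap_mem _ r
    | add x y hx hy ihx ihy => exact add_mem ihx ihy
    | ι_mul_ι_mul v w x hx ih => exact mul_mem (ι_mul_ι_mem_range_ofBaseChangeEven A q v w) ih

/-- The even Clifford algebra of a base-changed form is the base change of the even Clifford
algebra. -/
noncomputable def evenEquivBaseChange :
    even (q.baseChange A) ≃ₐ[A] A ⊗[R] (even q) :=
  ((AlgEquiv.ofInjective _ (ofBaseChangeEven_injective A q)).trans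
    (Subalgebra.equivOfEq _ _ (range_ofBaseChangeEven A q))).symm

end

end CliffordAlgebra

/-- **Proposition A.1(6)** of "Fibrations in complete intersections of quadrics"
(affine case): formation of the even Clifford algebra commutes with base change along a
commutative `R`-algebra `A` in which 2 is invertible.  (The instance `Invertible (2 : R)`
is required for Mathlib's `QuadraticForm.baseChange` to be defined.) -/
theorem even_clifford_baseChange
    {R M A : Type*} [CommRing R] [AddCommGroup M] [Module R M]
    [CommRing A] [Algebra R A] [Invertible (2 : R)] [Invertible (2 : A)]
    (q : QuadraticForm R M) :
    Nonempty ((CliffordAlgebra.even (q.baseChange A)) ≃ₐ[A]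
      (A ⊗[R] (CliffordAlgebra.even q))) := by
  exact ⟨CliffordAlgebra.evenEquivBaseChange A q⟩
end

section
/- Let R be a commutative ring, M an R-module, q : M → R a quadratic form, and u a unit of R. Then there is an isomorphism of R-algebras between the even Clifford algebra of the scaled quadratic form u • q and the even Clifford algebra of q. -/
namespace CliffordAlgebra

section EvenScaling

variable {R M A : Type*} [CommRing R] [AddCommGroup M] [Module R M] [Ring A] [Algebra R A]

/-- Scaling an `EvenHom` for `Q` by `c` gives an `EvenHom` for any form equal to `c` times `Q`. -/
def EvenHom.scale {Q Q' : QuadraticForm R M} (c : R) (h : ∀ m, Q' m = c * Q m)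
    (f : EvenHom Q A) : EvenHom Q' A where
  bilin := c • f.bilin
  contract m := by
    simp [f.contract, h, Algebra.smul_def]
  contract_mid m₁ m₂ m₃ := by
    simp only [LinearMap.smul_apply, smul_mul_assoc, mul_smul_comm, f.contract_mid, h, smul_smul]
    congr 1
    ring

/-- The algebra morphism between even Clifford algebras of proportional forms which multiplies
products of two vectors by the ratio of the forms. -/
def even.scale {Q Q' : QuadraticForm R M} (c : R) (h : ∀ m, Q' m = c * Q m) :
    even Q' →ₐ[R] even Q :=
  even.lift Q' ((even.ι Q).scale c h)

theorem even.scale_ι {Q Q' : QuadraticForm R M} (c : R) (h : ∀ m, Q' m = c * Q m) (m₁ m₂ : M) :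
    even.scale c h ((even.ι Q').bilin m₁ m₂) = c • (even.ι Q).bilin m₁ m₂ :=
  even.lift_ι Q' _ m₁ m₂

theorem even.scale_comp_scale {Q Q' : QuadraticForm R M} {c d : R} (h : ∀ m, Q' m = c * Q m)
    (h' : ∀ m, Q m = d * Q' m) (hdc : d * c = 1) :
    (even.scale c h).comp (even.scale d h') = AlgHom.id R (even Q) := by
  refine even.algHom_ext Q (EvenHom.ext (LinearMap.ext₂ fun m₁ m₂ => ?_))
  change even.scale c h (even.scale d h' ((even.ι Q).bilin m₁ m₂)) = (even.ι Q).bilin m₁ m₂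
  rw [even.scale_ι, map_smul, even.scale_ι, smul_smul, hdc, one_smul]

/-- The even Clifford algebra is invariant under scaling the quadratic form by a unit. -/
def even.equivUnitSMul (Q : QuadraticForm R M) (u : Rˣ) : even ((u : R) • Q) ≃ₐ[R] even Q :=
  have h : ∀ m, ((u : R) • Q) m = u * Q m := fun _ => rfl
  have h' : ∀ m, Q m = (↑u⁻¹ : R) * ((u : R) • Q) m := fun m => by rw [h, Units.inv_mul_cancel_left]
  AlgEquiv.ofAlgHom (even.scale u h) (even.scale (↑u⁻¹ : R) h')
    (even.scale_comp_scale h h' u.inv_mul) (even.scale_comp_scale h' h u.mul_inv)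

end EvenScaling

end CliffordAlgebra

/-- **Proposition A.1(5)** of "Fibrations in complete intersections of quadrics"
(affine case): the even Clifford algebra is invariant under scaling the quadratic form
by a unit. -/
theorem even_clifford_unit_smul
    {R M : Type*} [CommRing R] [AddCommGroup M] [Module R M]
    (q : QuadraticForm R M) (u : Rˣ) :
    Nonempty ((CliffordAlgebra.even ((u : R) • q)) ≃ₐ[R] (CliffordAlgebra.even q)) := by
  exact ⟨CliffordAlgebra.even.equivUnitSMul q u⟩
end

section
/- Let R be a nontrivial commutative ring, M a finite free R-module of rank n ≥ 1, and q : M → R a quadratic form. Then the even part evenOdd q 0 and the odd part evenOdd q 1 of the Clifford algebra CliffordAlgebra q are each free R-modules of rank 2^(n−1). -/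
namespace CliffordAlgebra

open LinearMap (BilinForm)

variable {R M : Type*} [CommRing R] [AddCommGroup M] [Module R M] {Q Q' : QuadraticForm R M}

theorem ι_mul_mem_evenOdd {i : ZMod 2} (m : M) {x : CliffordAlgebra Q} (hx : x ∈ evenOdd Q i) :
    ι Q m * x ∈ evenOdd Q (i + 1) :=
  add_comm 1 i ▸ SetLike.mul_mem_graded (ι_mem_evenOdd_one Q m) hx

theorem ι_mul_ι_mul_mem_evenOdd {i : ZMod 2} (m₁ m₂ : M) {x : CliffordAlgebra Q}
    (hx : x ∈ evenOdd Q i) : ι Q m₁ * (ι Q m₂ * x) ∈ evenOdd Q i := by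
  have h := ι_mul_mem_evenOdd m₁ (ι_mul_mem_evenOdd m₂ hx)
  rwa [add_assoc, CharTwo.add_self_eq_zero, add_zero] at h

theorem contractLeft_mem_evenOdd {i : ZMod 2} (d : Module.Dual R M) {x : CliffordAlgebra Q}
    (hx : x ∈ evenOdd Q i) : contractLeft d x ∈ evenOdd Q (i + 1) := by
  induction x, hx using evenOdd_induction with
  | range_ι_pow v hv =>
    fin_cases i
    · obtain ⟨r, rfl⟩ := Submodule.mem_one.mp hv
      simp
    · obtain ⟨m, rfl⟩ := (pow_one (LinearMap.range (ι Q))).le hv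
      rw [contractLeft_ι]
      exact SetLike.algebraMap_mem_graded (evenOdd Q) _
  | add x y _ _ hx hy =>
    rw [map_add]
    exact add_mem hx hy
  | ι_mul_ι_mul m₁ m₂ x hx ih =>
    rw [mul_assoc, contractLeft_ι_mul, contractLeft_ι_mul, mul_sub, mul_smul_comm]
    exact sub_mem (Submodule.smul_mem _ _ (ι_mul_mem_evenOdd m₂ hx))
      (sub_mem (Submodule.smul_mem _ _ (ι_mul_mem_evenOdd m₁ hx))
        (ι_mul_ι_mul_mem_evenOdd m₁ m₂ ih))

theorem changeForm_mem_evenOdd {B : BilinForm R M} (h : B.toQuadraticMap = Q' - Q) {i : ZMod 2}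
    {x : CliffordAlgebra Q} (hx : x ∈ evenOdd Q i) : changeForm h x ∈ evenOdd Q' i := by
  induction x, hx using evenOdd_induction with
  | range_ι_pow v hv =>
    fin_cases i
    · obtain ⟨r, rfl⟩ := Submodule.mem_one.mp hv
      rw [changeForm_algebraMap]
      exact SetLike.algebraMap_mem_graded (evenOdd Q') _
    · obtain ⟨m, rfl⟩ := (pow_one (LinearMap.range (ι Q))).le hv
      rw [changeForm_ι]
      exact ι_mem_evenOdd_one Q' m
  | add x y _ _ hx hy =>
    rw [map_add]
    exact add_mem hx hy
  | ι_mul_ι_mul m₁ m₂ x hx ih =>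
    have key : changeForm h (ι Q m₂ * x) ∈ evenOdd Q' (i + 1) := by
      rw [changeForm_ι_mul]
      exact sub_mem (ι_mul_mem_evenOdd m₂ ih) (contractLeft_mem_evenOdd _ ih)
    rw [mul_assoc, changeForm_ι_mul]
    have h₂ : i + 1 + 1 = i := by rw [add_assoc, CharTwo.add_self_eq_zero, add_zero]
    exact sub_mem (h₂ ▸ ι_mul_mem_evenOdd m₁ key) (h₂ ▸ contractLeft_mem_evenOdd _ key)

theorem map_changeFormEquiv_evenOdd {B : BilinForm R M} (h : B.toQuadraticMap = Q' - Q)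
    (i : ZMod 2) :
    (evenOdd Q i).map (changeFormEquiv h : CliffordAlgebra Q →ₗ[R] CliffordAlgebra Q') =
      evenOdd Q' i := by
  refine le_antisymm (Submodule.map_le_iff_le_comap.mpr fun x hx => changeForm_mem_evenOdd h hx)
    fun y hy => ⟨(changeFormEquiv h).symm y, ?_, (changeFormEquiv h).apply_symm_apply y⟩
  rw [changeFormEquiv_symm]
  exact changeForm_mem_evenOdd (changeForm.neg_proof h) hy

/-- The even (odd) parts of Clifford algebras of forms differing by a bilinear form are
isomorphic. -/
noncomputable def evenOddChangeFormEquiv {B : BilinForm R M} (h : B.toQuadraticMap = Q' - Q)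
    (i : ZMod 2) : evenOdd Q i ≃ₗ[R] evenOdd Q' i :=
  (changeFormEquiv h).ofSubmodules _ _ (map_changeFormEquiv_evenOdd h i)

end CliffordAlgebra

namespace ExteriorAlgebra

open Module

variable {R M I : Type*} [CommRing R] [AddCommGroup M] [Module R M] [LinearOrder I]

theorem span_basis_card_eq (b : Basis I R M) (n : ℕ) :
    Submodule.span R (b.ExteriorAlgebra '' {s | s.card = n}) = ⋀[R]^n M := by
  rw [← exteriorPower.ιMulti_family_span_fixedDegree_of_span R b.span_eq]
  congr 1
  ext x
  constructor
  · rintro ⟨s, hs, rfl⟩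
    exact ⟨_, (basis_apply_ofCard b hs).symm⟩
  · rintro ⟨s, rfl⟩
    exact ⟨s, s.2, basis_apply_powersetCard b s⟩

theorem span_basis_card_parity (b : Basis I R M) (i : ZMod 2) :
    Submodule.span R (Set.range fun s : {s : Finset I // (s.card : ZMod 2) = i} =>
      b.ExteriorAlgebra s) = CliffordAlgebra.evenOdd (0 : QuadraticForm R M) i := by
  have h : CliffordAlgebra.evenOdd (0 : QuadraticForm R M) i =
      ⨆ j : {n : ℕ // (n : ZMod 2) = i}, ⋀[R]^(j : ℕ) M := rfl
  rw [h]
  simp_rw [← span_basis_card_eq b]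
  rw [← Submodule.span_iUnion]
  congr 1
  ext x
  simp only [Set.mem_range, Set.mem_iUnion, Set.mem_image, Set.mem_ofPred_eq, Subtype.exists]
  constructor
  · rintro ⟨s, hs, rfl⟩
    exact ⟨_, hs, s, rfl, rfl⟩
  · rintro ⟨n, hn, s, rfl, rfl⟩
    exact ⟨s, hn, rfl⟩

/-- The basis of the even (odd) part of the exterior algebra given by the products of an even
(odd) number of elements of a basis of `M`. -/
noncomputable def evenOddBasis (b : Basis I R M) (i : ZMod 2) :
    Basis {s : Finset I // (s.card : ZMod 2) = i} R
      (CliffordAlgebra.evenOdd (0 : QuadraticForm R M) i) :=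
  (Basis.span (b.ExteriorAlgebra.linearIndependent.comp _ Subtype.val_injective)).map
    (LinearEquiv.ofEq _ _ (span_basis_card_parity b i))

end ExteriorAlgebra

theorem Finset.card_subtype_card_parity (α : Type*) [Fintype α] [Nonempty α] (i : ZMod 2) :
    Fintype.card {s : Finset α // (s.card : ZMod 2) = i} = 2 ^ (Fintype.card α - 1) := by
  classical
  have indicator (s : Finset α) : (2 * if (s.card : ZMod 2) = i then 1 else 0 : ℤ) =
      1 + (-1) ^ i.val * (-1) ^ s.card := by
    rw [← pow_add]
    have hi : (s.card : ZMod 2) = i ↔ Even (i.val + s.card) := by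
      rw [← ZMod.natCast_eq_zero_iff_even, Nat.cast_add, ZMod.natCast_zmod_val,
        CharTwo.add_eq_zero, eq_comm]
    by_cases h : Even (i.val + s.card)
    · rw [if_pos (hi.mpr h), h.neg_one_pow]; norm_num
    · rw [if_neg (mt hi.mp h), (Nat.not_even_iff_odd.mp h).neg_one_pow]; norm_num
  have alternating := Finset.sum_powerset_neg_one_pow_card_of_nonempty
    (Finset.univ_nonempty (α := α))
  rw [Finset.powerset_univ] at alternating
  have double : (2 * Fintype.card {s : Finset α // (s.card : ZMod 2) = i} : ℤ) =
      2 ^ Fintype.card α := by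
    rw [Fintype.card_subtype, Finset.card_filter]
    push_cast
    rw [Finset.mul_sum, Finset.sum_congr rfl fun s _ => indicator s, Finset.sum_add_distrib,
      ← Finset.mul_sum, alternating]
    simp
  have pos : Fintype.card α = Fintype.card α - 1 + 1 :=
    (Nat.succ_pred_eq_of_pos Fintype.card_pos).symm
  rw [pos, pow_succ'] at double
  exact_mod_cast mul_left_cancel₀ two_ne_zero double

theorem CliffordAlgebra.free_and_finrank_evenOdd {R M : Type*} [CommRing R] [Nontrivial R]
    [AddCommGroup M] [Module R M] [Module.Free R M] [Module.Finite R M]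
    (h1 : 1 ≤ Module.finrank R M) (q : QuadraticForm R M) (i : ZMod 2) :
    Module.Free R (evenOdd q i) ∧
      Module.finrank R (evenOdd q i) = 2 ^ (Module.finrank R M - 1) := by
  obtain ⟨B, hB⟩ := LinearMap.BilinMap.toQuadraticMap_surjective q
  let b := Module.finBasis R M
  have : Nonempty (Fin (Module.finrank R M)) := ⟨⟨0, h1⟩⟩
  let c := (ExteriorAlgebra.evenOddBasis b i).map
    (evenOddChangeFormEquiv (hB.trans (sub_zero q).symm) i)
  refine ⟨Module.Free.of_basis c, ?_⟩
  rw [Module.finrank_eq_card_basis c, Finset.card_subtype_card_parity, Fintype.card_fin]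


/-- **Proposition A.1(1)** of "Fibrations in complete intersections of quadrics"
(affine case, together with the corresponding statement for the Clifford bimodule):
for a quadratic form on a finite free module of rank `n ≥ 1` over a nontrivial
commutative ring, the even and odd parts of the Clifford algebra are free modules of
rank `2 ^ (n - 1)`. -/
theorem evenOdd_free_rank_two_pow
    {R M : Type*} [CommRing R] [Nontrivial R] [AddCommGroup M] [Module R M]
    [Module.Free R M] [Module.Finite R M]
    (n : ℕ) (hn : Module.finrank R M = n) (h1 : 1 ≤ n)
    (q : QuadraticForm R M) :
    (Module.Free R ↥(CliffordAlgebra.evenOdd q 0) ∧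
      Module.finrank R ↥(CliffordAlgebra.evenOdd q 0) = 2 ^ (n - 1)) ∧
    (Module.Free R ↥(CliffordAlgebra.evenOdd q 1) ∧
      Module.finrank R ↥(CliffordAlgebra.evenOdd q 1) = 2 ^ (n - 1)) := by
  subst hn
  exact ⟨CliffordAlgebra.free_and_finrank_evenOdd h1 q 0,
    CliffordAlgebra.free_and_finrank_evenOdd h1 q 1⟩
end
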